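/- The set of all Gödel logics, i.e. {G_V : V a Gödel set}, is countable. -/

import Mathlib

open Set

/-- Formulas of a relational first-order language with countably many predicate
symbols (symbol `p` has arity `ar p`); variables are de Bruijn indices. -/
inductive GFormula (ar : ℕ → ℕ) : Type
  | bot : GFormula ar
  | atom (p : ℕ) (ts : Fin (ar p) → ℕ) : GFormula ar
  | conj : GFormula ar → GFormula ar → GFormula ar
  | disj : GFormula ar → GFormula ar → GFormula ar
  | imp : GFormula ar → GFormula ar → GFormula ar
  | all : GFormula ar → GFormula ar
  | ex : GFormula ar → GFormula ar

/-- All free variables of the formula are `< k`. -/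
def GFormula.VarsBelow {ar : ℕ → ℕ} : ℕ → GFormula ar → Prop
  | _, .bot => True
  | k, .atom _ ts => ∀ i, ts i < k
  | k, .conj φ ψ => φ.VarsBelow k ∧ ψ.VarsBelow k
  | k, .disj φ ψ => φ.VarsBelow k ∧ ψ.VarsBelow k
  | k, .imp φ ψ => φ.VarsBelow k ∧ ψ.VarsBelow k
  | k, .all φ => φ.VarsBelow (k+1)
  | k, .ex φ => φ.VarsBelow (k+1)

/-- A closed formula (sentence). -/
def GFormula.IsClosedF {ar : ℕ → ℕ} (φ : GFormula ar) : Prop := φ.VarsBelow 0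

/-- The syntactic subformulas of a formula. -/
def GFormula.Subfs {ar : ℕ → ℕ} : GFormula ar → Set (GFormula ar)
  | .bot => {.bot}
  | .atom p ts => {.atom p ts}
  | .conj φ ψ => insert (.conj φ ψ) (φ.Subfs ∪ ψ.Subfs)
  | .disj φ ψ => insert (.disj φ ψ) (φ.Subfs ∪ ψ.Subfs)
  | .imp φ ψ => insert (.imp φ ψ) (φ.Subfs ∪ ψ.Subfs)
  | .all φ => insert (.all φ) φ.Subfs
  | .ex φ => insert (.ex φ) φ.Subfs

/-- A Gödel set: a closed subset of `[0,1]` containing `0` and `1`. -/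
def GodelSet (V : Set ℝ) : Prop :=
  IsClosed V ∧ V ⊆ Set.Icc (0:ℝ) 1 ∧ (0:ℝ) ∈ V ∧ (1:ℝ) ∈ V

/-- A valuation into `V`: a nonempty universe `M` together with interpretations of
all predicate symbols, taking values in `V`. -/
structure GValuation (ar : ℕ → ℕ) (V : Set ℝ) where
  M : Type
  ne : Nonempty M
  interp : ∀ p : ℕ, (Fin (ar p) → M) → ℝ
  interp_mem : ∀ p t, interp p t ∈ V

/-- Prepend a value to an environment. -/
def consEnv {M : Type} (m : M) (e : ℕ → M) : ℕ → M
  | 0 => m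
  | n+1 => e n

/-- The Gödel value of a formula under a valuation and an environment. -/
noncomputable def geval {ar : ℕ → ℕ} {V : Set ℝ} (v : GValuation ar V) :
    (ℕ → v.M) → GFormula ar → ℝ
  | _, .bot => 0
  | e, .atom p ts => v.interp p (fun i => e (ts i))
  | e, .conj φ ψ => min (geval v e φ) (geval v e ψ)
  | e, .disj φ ψ => max (geval v e φ) (geval v e ψ)
  | e, .imp φ ψ => if geval v e φ ≤ geval v e ψ then 1 else geval v e ψ
  | e, .all φ => sInf (Set.range fun m : v.M => geval v (consEnv m e) φ)
  | e, .ex φ => sSup (Set.range fun m : v.M => geval v (consEnv m e) φ)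

/-- The value `v(φ)` of a closed formula. -/
noncomputable def GValuation.val {ar : ℕ → ℕ} {V : Set ℝ}
    (v : GValuation ar V) (φ : GFormula ar) : ℝ :=
  geval v (fun _ => Classical.choice v.ne) φ

/-- `‖φ‖_V`: the infimum of `v(φ)` over all valuations `v` into `V`. -/
noncomputable def GNorm (ar : ℕ → ℕ) (V : Set ℝ) (φ : GFormula ar) : ℝ :=
  sInf (Set.range fun v : GValuation ar V => v.val φ)

/-- The Gödel logic of `V`: all closed formulas with `‖φ‖_V = 1`. -/
def GLogic (ar : ℕ → ℕ) (V : Set ℝ) : Set (GFormula ar) :=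
  {φ | φ.IsClosedF ∧ GNorm ar V φ = 1}

namespace GodelCount

/-! ### Clopen Ramsey theorem for infinite sets of natural numbers -/

theorem exists_homogeneous_step {κ : Type*} [Finite κ] (c : Set ℕ → κ) (A s : Set ℕ) (n : ℕ)
    (h : ∀ a ∈ A, n ≤ a → ∀ S ⊆ A, S.Infinite → ∃ B ⊆ S, B.Infinite ∧
      ∃ k, ∀ X ⊆ B, X.Infinite → (∀ x ∈ X, a + 1 ≤ x) → c (insert a s ∪ X) = k)
    {S : Set ℕ} (hSA : S ⊆ A) (hS : S.Infinite) :
    ∃ B ⊆ S, B.Infinite ∧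
      ∃ k, ∀ X ⊆ B, X.Infinite → (∀ x ∈ X, n ≤ x) → c (s ∪ X) = k := by
  have step : ∀ P : {P : Set ℕ // P ⊆ A ∧ P.Infinite ∧ ∀ x ∈ P, n ≤ x},
      ∃ Q : {P : Set ℕ // P ⊆ A ∧ P.Infinite ∧ ∀ x ∈ P, n ≤ x}, ∃ a ∈ P.1, ∃ k,
        Q.1 ⊆ P.1 ∧ (∀ x ∈ Q.1, a < x) ∧
        ∀ X ⊆ Q.1, X.Infinite → c (insert a s ∪ X) = k := by
    rintro ⟨P, hPA, hP, hPn⟩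
    obtain ⟨a, ha⟩ := hP.nonempty
    have hinf : (P ∩ Ioi a).Infinite := by
      intro hf
      refine hP ((hf.union (finite_Iic a)).subset fun x hx => ?_)
      rcases le_or_gt x a with h1 | h1
      · exact Or.inr h1
      · exact Or.inl ⟨hx, h1⟩
    obtain ⟨B, hB, hBi, k, hk⟩ := h a (hPA ha) (hPn a ha) (P ∩ Ioi a)
      (inter_subset_left.trans hPA) hinf
    refine ⟨⟨B, hB.trans (inter_subset_left.trans hPA), hBi, fun x hx => hPn x (hB hx).1⟩,
      a, ha, k, fun x hx => (hB hx).1, fun x hx => (hB hx).2, fun X hX hXi => ?_⟩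
    exact hk X hX hXi fun x hx => (hB (hX hx)).2
  choose nxt a ha k hsub hlt hk using step
  have hS0 : (S ∩ Ici n).Infinite := by
    intro hf
    refine hS ((hf.union (finite_Iio n)).subset fun x hx => ?_)
    rcases le_or_gt n x with h1 | h1
    · exact Or.inl ⟨hx, h1⟩
    · exact Or.inr h1
  let P : ℕ → {P : Set ℕ // P ⊆ A ∧ P.Infinite ∧ ∀ x ∈ P, n ≤ x} := fun i =>
    Nat.rec ⟨S ∩ Ici n, inter_subset_left.trans hSA, hS0, fun x hx => hx.2⟩ (fun _ Q => nxt Q) i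
  have hPs : ∀ i, P (i + 1) = nxt (P i) := fun i => rfl
  have hanti : ∀ i j, i ≤ j → (P j).1 ⊆ (P i).1 := by
    intro i j hij
    induction j, hij using Nat.le_induction with
    | base => exact subset_rfl
    | succ j _ ih => rw [hPs]; exact (hsub _).trans ih
  have hmono : StrictMono fun i => a (P i) := by
    refine strictMono_nat_of_lt_succ fun i => hlt (P i) _ ?_
    rw [← hPs]; exact ha _
  obtain ⟨k₀, hk₀⟩ := Finite.exists_infinite_fiber fun i => k (P i)
  rw [Set.infinite_coe_iff] at hk₀
  refine ⟨(fun i => a (P i)) '' ((fun i => k (P i)) ⁻¹' {k₀}), ?_,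
    hk₀.image hmono.injective.injOn, k₀, ?_⟩
  · rintro _ ⟨i, -, rfl⟩
    exact (hanti 0 i (Nat.zero_le i) (ha _)).1
  · intro X hX hXi hXn
    have hmin := Nat.sInf_mem hXi.nonempty
    obtain ⟨i, hi, hai⟩ := hX hmin
    have : s ∪ X = insert (a (P i)) s ∪ (X \ {a (P i)}) := by
      have hmem : a (P i) ∈ X := by
        have h2 : a (P i) = sInf X := hai
        rw [h2]; exact hmin
      ext x
      by_cases hx : x = a (P i)
      · subst hx; simp [hmem]
      · simp [hx]
    rw [this, hk (P i) _ _ (hXi.sdiff (finite_singleton _))]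
    · exact hi
    · rintro x ⟨hx, hne⟩
      obtain ⟨j, hj, rfl⟩ := hX hx
      have h1 : sInf X ≤ a (P j) := Nat.sInf_le hx
      have h2 : i < j := by
        have h3 : a (P i) < a (P j) := by
          have h4 : a (P i) = sInf X := hai
          rw [← h4] at h1
          exact lt_of_le_of_ne h1 fun h => hne h.symm
        exact hmono.lt_iff_lt.1 h3
      rw [← hPs]
      exact hanti (i + 1) j h2 (ha _)

theorem exists_homogeneous {κ : Type*} [Finite κ] (c : Set ℕ → κ) {A : Set ℕ} (hA : A.Infinite)
    (m : Set ℕ → ℕ)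
    (hc : ∀ X ⊆ A, X.Infinite → ∀ Y ⊆ A, Y.Infinite → X ∩ Iic (m X) = Y ∩ Iic (m X) → c Y = c X) :
    ∃ B ⊆ A, B.Infinite ∧ ∃ k, ∀ X ⊆ B, X.Infinite → c X = k := by
  let R : Set ℕ → ℕ → Prop := fun s n => ∀ S ⊆ A, S.Infinite → ∃ B ⊆ S, B.Infinite ∧
      ∃ k, ∀ X ⊆ B, X.Infinite → (∀ x ∈ X, n ≤ x) → c (s ∪ X) = k
  suffices hR : R ∅ 0 by
    obtain ⟨B, hB, hBi, k, hk⟩ := hR A subset_rfl hA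
    refine ⟨B, hB, hBi, k, fun X hX hXi => ?_⟩
    simpa using hk X hX hXi fun _ _ => Nat.zero_le _
  by_contra h0
  have step : ∀ q : {q : Set ℕ × ℕ // ¬ R q.1 q.2}, ∃ a ∈ A, q.1.2 ≤ a ∧
      ¬ R (insert a q.1.1) (a + 1) := by
    rintro ⟨⟨s, n⟩, hq⟩
    by_contra! hcon
    exact hq fun S hSA hS => exists_homogeneous_step c A s n hcon hSA hS
  choose a haA hna haR using step
  let q : ℕ → {q : Set ℕ × ℕ // ¬ R q.1 q.2} := fun i =>
    Nat.rec ⟨(∅, 0), h0⟩ (fun _ q => ⟨(insert (a q) q.1.1, a q + 1), haR q⟩) i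
  have hq1 : ∀ i, (q (i + 1)).1.1 = insert (a (q i)) (q i).1.1 := fun i => rfl
  have hq2 : ∀ i, (q (i + 1)).1.2 = a (q i) + 1 := fun i => rfl
  have hmono : StrictMono fun i => a (q i) := by
    refine strictMono_nat_of_lt_succ fun i => ?_
    have := hna (q (i + 1))
    rw [hq2] at this
    exact this
  have hs : ∀ i, (q i).1.1 = range (fun i => a (q i)) ∩ Iio (q i).1.2 := by
    intro i
    induction i with
    | zero =>
      ext x
      change x ∈ (∅ : Set ℕ) ↔ x ∈ range (fun i => a (q i)) ∧ x < 0
      simp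
    | succ i ih =>
      rw [hq1, hq2, ih]
      ext x
      simp only [mem_insert_iff, mem_inter_iff, mem_range, mem_Iio]
      constructor
      · rintro (rfl | ⟨h1, h2⟩)
        · exact ⟨⟨i, rfl⟩, Nat.lt_succ_self _⟩
        · exact ⟨h1, by have := hna (q i); omega⟩
      · rintro ⟨⟨j, rfl⟩, h2⟩
        rcases lt_trichotomy j i with h | h | h
        · right
          refine ⟨⟨j, rfl⟩, ?_⟩
          obtain ⟨i, rfl⟩ : ∃ i', i = i' + 1 := ⟨i - 1, by omega⟩
          rw [hq2]
          have := hmono.monotone (show j ≤ i by omega)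
          exact Nat.lt_succ_of_le this
        · left; rw [h]
        · have h3 : a (q i) < a (q j) := hmono h
          omega
  set X := range fun i => a (q i) with hX
  have hXi : X.Infinite := infinite_range_of_injective hmono.injective
  have hXA : X ⊆ A := by rintro _ ⟨i, rfl⟩; exact haA _
  have hlt : m X < (q (m X + 1)).1.2 := by
    rw [hq2]; exact Nat.lt_succ_of_le (hmono.id_le _)
  have hsm := hs (m X + 1)
  have hnR := (q (m X + 1)).2
  revert hsm hnR hlt
  generalize (q (m X + 1)).1 = r
  intro hlt hsm hnR
  refine hnR fun S hSA hS => ⟨S, subset_rfl, hS, c X, fun Y hY hYi hYn => ?_⟩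
  refine hc X hXA hXi _ (union_subset ?_ (hY.trans hSA)) (hYi.mono subset_union_right) ?_
  · rw [hsm]; exact inter_subset_left.trans hXA
  · ext x
    rw [hsm]
    simp only [mem_inter_iff, mem_Iic, mem_union, mem_Iio]
    constructor
    · rintro ⟨h1, h2⟩; exact ⟨Or.inl ⟨h1, by omega⟩, h2⟩
    · rintro ⟨h1 | h1, h2⟩
      · exact ⟨h1.1, h2⟩
      · have := hYn x h1; omega

/-- Remove the least element. -/
def shift (X : Set ℕ) : Set ℕ := X \ {sInf X}

theorem shift_subset (X : Set ℕ) : shift X ⊆ X := sdiff_subset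

theorem shift_infinite {X : Set ℕ} (hX : X.Infinite) : (shift X).Infinite :=
  hX.sdiff (finite_singleton _)

theorem shift_inter_eq {X Y : Set ℕ} {p : ℕ} (hX : X.Infinite) (hY : Y.Infinite)
    (hp : sInf X ≤ p) (h : X ∩ Iic p = Y ∩ Iic p) : shift X ∩ Iic p = shift Y ∩ Iic p := by
  have hXm := Nat.sInf_mem hX.nonempty
  have hYm := Nat.sInf_mem hY.nonempty
  have h1 : sInf X ∈ Y := by
    have : sInf X ∈ Y ∩ Iic p := h ▸ ⟨hXm, hp⟩
    exact this.1
  have h2 : sInf Y ≤ sInf X := Nat.sInf_le h1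
  have h3 : sInf Y ∈ X := by
    have : sInf Y ∈ X ∩ Iic p := h ▸ ⟨hYm, h2.trans hp⟩
    exact this.1
  have h4 : sInf X = sInf Y := le_antisymm (Nat.sInf_le h3) h2
  ext x
  have := Set.ext_iff.1 h x
  simp only [shift, mem_inter_iff, mem_sdiff, mem_singleton_iff, h4] at this ⊢
  tauto

/-! ### Minimal bad arrays -/

/-- A bad array: a locally constant map on infinite subsets of `A` (with modulus `m`), such that
no value is below the value at the shifted set. -/
structure BArr {T : Type*} (le : T → T → Prop) where
  A : Set ℕ
  inf : A.Infinite
  f : Set ℕ → T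
  m : Set ℕ → ℕ
  loc : ∀ X ⊆ A, X.Infinite → ∀ Y ⊆ A, Y.Infinite → X ∩ Iic (m X) = Y ∩ Iic (m X) →
    f Y = f X ∧ m Y = m X
  mem : ∀ X ⊆ A, X.Infinite → m X ∈ X
  smooth : ∀ X ⊆ A, X.Infinite → m X ≤ m (shift X)
  bad : ∀ X ⊆ A, X.Infinite → ¬ le (f X) (f (shift X))

namespace BArr

variable {T : Type*} {le lt : T → T → Prop}

/-- `C'` refines `C`, changing only values with modulus at least `p`, and only downwards. -/
def Ext (lt : T → T → Prop) (p : ℕ) (C C' : BArr le) : Prop :=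
  C'.A ⊆ C.A ∧ ∀ X ⊆ C'.A, X.Infinite →
    (C'.f X = C.f X ∧ C'.m X = C.m X) ∨ (lt (C'.f X) (C.f X) ∧ p ≤ C.m X ∧ C.m X ≤ C'.m X)

/-- `H` is strictly below `C` at every set. -/
def StrictBelow (lt : T → T → Prop) (H C : BArr le) : Prop :=
  H.A ⊆ C.A ∧ ∀ X ⊆ H.A, X.Infinite → lt (H.f X) (C.f X) ∧ C.m X ≤ H.m X

/-- No array strictly below `C` is defined at a set with initial part `t` and modulus `p`. -/
def MinAt (lt : T → T → Prop) (C : BArr le) (t : Set ℕ) (p : ℕ) : Prop :=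
  ∀ X ⊆ C.A, X.Infinite → X ∩ Iic p = t → C.m X = p → ¬ ∃ H, StrictBelow lt H C ∧ X ⊆ H.A

theorem Ext.refl (p : ℕ) (C : BArr le) : Ext lt p C C :=
  ⟨subset_rfl, fun _ _ _ => Or.inl ⟨rfl, rfl⟩⟩

theorem Ext.mono {p q : ℕ} (h : p ≤ q) {C C' : BArr le} (hE : Ext lt q C C') : Ext lt p C C' := by
  refine ⟨hE.1, fun X hX hi => ?_⟩
  rcases hE.2 X hX hi with h1 | h1
  · exact Or.inl h1
  · exact Or.inr ⟨h1.1, h.trans h1.2.1, h1.2.2⟩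

theorem Ext.trans (htr : ∀ a b c, lt a b → lt b c → lt a c) {p : ℕ} {C C' C'' : BArr le}
    (h1 : Ext lt p C C') (h2 : Ext lt p C' C'') : Ext lt p C C'' := by
  refine ⟨h2.1.trans h1.1, fun X hX hi => ?_⟩
  rcases h1.2 X (hX.trans h2.1) hi with a | a <;> rcases h2.2 X hX hi with b | b
  · exact Or.inl ⟨b.1.trans a.1, b.2.trans a.2⟩
  · rw [a.1, a.2] at b; exact Or.inr b
  · rw [← b.1, ← b.2] at a; exact Or.inr a
  · exact Or.inr ⟨htr _ _ _ b.1 a.1, a.2.1, a.2.2.trans b.2.2⟩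

theorem StrictBelow.of_ext (htr : ∀ a b c, lt a b → lt b c → lt a c) {p : ℕ} {C C' H : BArr le}
    (h1 : StrictBelow lt H C') (h2 : Ext lt p C C') : StrictBelow lt H C := by
  refine ⟨h1.1.trans h2.1, fun X hX hi => ?_⟩
  have a := h1.2 X hX hi
  rcases h2.2 X (hX.trans h1.1) hi with b | b
  · rw [b.1, b.2] at a; exact a
  · exact ⟨htr _ _ _ a.1 b.1, b.2.2.trans a.2⟩

theorem MinAt.of_ext (htr : ∀ a b c, lt a b → lt b c → lt a c) {p : ℕ} {C C' : BArr le}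
    {t : Set ℕ} (h1 : MinAt lt C t p) (h2 : Ext lt p C C') : MinAt lt C' t p := by
  rintro X hX hi ht hm ⟨H, hH, hXH⟩
  refine h1 X (hX.trans h2.1) hi ht ?_ ⟨H, hH.of_ext htr h2, hXH⟩
  rcases h2.2 X hX hi with b | b
  · exact b.2 ▸ hm
  · exact le_antisymm (hm ▸ b.2.2) b.2.1

theorem le_m_of_tail (C : BArr le) {X₀ X : Set ℕ} (h₀ : X₀ ⊆ C.A) (hi₀ : X₀.Infinite)
    (hX : X ⊆ C.A) (hi : X.Infinite) (n : ℕ)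
    (hn : X ∩ Iic (C.m X₀) = X₀ ∩ Iic (C.m X₀) ∩ Ici n) : C.m X₀ ≤ C.m X := by
  set p := C.m X₀ with hp
  have hi' : (X ∩ Ioi p).Infinite := by
    intro hf
    refine hi ((hf.union (finite_Iic p)).subset fun x hx => ?_)
    rcases le_or_gt x p with h1 | h1
    · exact Or.inr h1
    · exact Or.inl ⟨hx, h1⟩
  have key : ∀ n, p ≤ C.m ((X₀ ∩ Iic p ∩ Ici n) ∪ (X ∩ Ioi p)) := by
    intro n
    have hsub : ∀ n, (X₀ ∩ Iic p ∩ Ici n) ∪ (X ∩ Ioi p) ⊆ C.A := fun n =>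
      union_subset (fun x hx => h₀ hx.1.1) (fun x hx => hX hx.1)
    have hinf : ∀ n, ((X₀ ∩ Iic p ∩ Ici n) ∪ (X ∩ Ioi p)).Infinite := fun n =>
      hi'.mono subset_union_right
    induction n with
    | zero =>
      refine ((C.loc X₀ h₀ hi₀ _ (hsub 0) (hinf 0) ?_).2).ge
      ext x
      simp only [mem_inter_iff, mem_Iic, mem_union, mem_Ici, mem_Ioi, ← hp]
      constructor
      · rintro ⟨h1, h2⟩; exact ⟨Or.inl ⟨⟨h1, h2⟩, Nat.zero_le _⟩, h2⟩
      · rintro ⟨h1 | h1, h2⟩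
        · exact h1.1
        · omega
    | succ n ih =>
      by_cases hnt : n ∈ X₀ ∩ Iic p
      · refine (ih.trans (C.smooth _ (hsub n) (hinf n))).trans_eq ?_
        congr 1
        have hI : sInf ((X₀ ∩ Iic p ∩ Ici n) ∪ (X ∩ Ioi p)) = n := by
          refine le_antisymm (Nat.sInf_le (Or.inl ⟨hnt, le_refl n⟩)) ?_
          refine le_csInf (hinf n).nonempty ?_
          rintro x (hx | hx)
          · exact hx.2
          · exact (show n ≤ p from hnt.2).trans (le_of_lt hx.2)
        have hnp : n ≤ p := hnt.2
        rw [shift, hI]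
        ext x
        simp only [mem_inter_iff, mem_Iic, mem_union, mem_Ici, mem_Ioi, mem_sdiff,
          mem_singleton_iff]
        constructor
        · rintro ⟨h1 | h1, h2⟩
          · exact Or.inl ⟨h1.1, by omega⟩
          · exact Or.inr h1
        · rintro (h1 | h1)
          · exact ⟨Or.inl ⟨h1.1, by omega⟩, by omega⟩
          · exact ⟨Or.inr h1, by omega⟩
      · have : X₀ ∩ Iic p ∩ Ici (n + 1) = X₀ ∩ Iic p ∩ Ici n := by
          ext x
          constructor
          · rintro ⟨h1, h2⟩
            exact ⟨h1, Nat.le_of_succ_le h2⟩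
          · rintro ⟨h1, h2⟩
            refine ⟨h1, ?_⟩
            rcases Nat.lt_or_ge n x with h | h
            · exact h
            · exact absurd (le_antisymm h h2 ▸ h1) hnt
        rw [this]; exact ih
  have := key n
  rwa [← hn, ← inter_union_distrib_left, Iic_union_Ioi, inter_univ] at this

open Classical in
/-- Replace the values of `C` by those of `H` on all sets whose part below `C.m X₀` is a tail of
that of `X₀`. -/
theorem exists_patch (hle : ∀ a b c, le a b → lt b c → le a c)
    {C H : BArr le} (hH : StrictBelow lt H C) {X₀ : Set ℕ} (h₀ : X₀ ⊆ H.A) (hi₀ : X₀.Infinite) :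
    ∃ C' : BArr le, Ext lt (C.m X₀) C C' ∧ C'.A ∩ Iic (C.m X₀) = C.A ∩ Iic (C.m X₀) ∧
      ∀ X ⊆ C'.A, X.Infinite → X ∩ Iic (C.m X₀) = X₀ ∩ Iic (C.m X₀) →
        lt (C'.f X) (C.f X₀) := by
  have h₀C := h₀.trans hH.1
  set p := C.m X₀ with hp
  set A' : Set ℕ := (C.A ∩ Iic p) ∪ (H.A ∩ Ioi p) with hA'
  have hA'C : A' ⊆ C.A := union_subset (fun x hx => hx.1) (fun x hx => hH.1 hx.1)
  have hA'i : A'.Infinite := by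
    intro hf
    refine H.inf ((hf.union (finite_Iic p)).subset fun x hx => ?_)
    rcases le_or_gt x p with h1 | h1
    · exact Or.inr h1
    · exact Or.inl (Or.inr ⟨hx, h1⟩)
  let D : Set ℕ → Prop := fun X => ∃ n, X ∩ Iic p = X₀ ∩ Iic p ∩ Ici n
  have hDH : ∀ X ⊆ A', D X → X ⊆ H.A := by
    rintro X hX ⟨n, hn⟩ x hx
    rcases hX hx with h1 | h1
    · have : x ∈ X₀ ∩ Iic p ∩ Ici n := hn ▸ ⟨hx, h1.2⟩
      exact h₀ this.1.1
    · exact h1.1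
  have hDm : ∀ X ⊆ A', X.Infinite → D X → p ≤ C.m X := fun X hX hi ⟨n, hn⟩ =>
    C.le_m_of_tail h₀C hi₀ (hX.trans hA'C) hi n hn
  have hDs : ∀ X, X.Infinite → D X → D (shift X) := by
    rintro X hi ⟨n, hn⟩
    refine ⟨max n (sInf X + 1), ?_⟩
    have hne := Nat.sInf_mem hi.nonempty
    ext x
    have h1 := Set.ext_iff.1 hn x
    simp only [shift, mem_inter_iff, mem_sdiff, mem_singleton_iff, mem_Ici, mem_Iic,
      sup_le_iff] at h1 ⊢
    constructor
    · rintro ⟨⟨h2, h3⟩, h4⟩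
      have h5 := h1.1 ⟨h2, h4⟩
      have h6 : sInf X ≤ x := Nat.sInf_le h2
      exact ⟨h5.1, h5.2, by omega⟩
    · rintro ⟨h2, h3, h4⟩
      exact ⟨⟨(h1.2 ⟨h2, h3⟩).1, by omega⟩, h2.2⟩
  have hDa : ∀ X Y : Set ℕ, ∀ q, p ≤ q → X ∩ Iic q = Y ∩ Iic q → D X → D Y := by
    rintro X Y q hq h ⟨n, hn⟩
    refine ⟨n, ?_⟩
    rw [← hn]
    have : Iic p ⊆ Iic q := Iic_subset_Iic.2 hq
    rw [← inter_eq_self_of_subset_right this, ← inter_assoc, ← inter_assoc, h]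
  have hs : ∀ X ⊆ A', shift X ⊆ A' := fun X hX => (shift_subset X).trans hX
  let C' : BArr le :=
    { A := A'
      inf := hA'i
      f := fun X => if D X then H.f X else C.f X
      m := fun X => if D X then H.m X else C.m X
      loc := by
        intro X hX hXi Y hY hYi hXY
        by_cases hDX : D X
        · have hDY : D Y := by
            rw [if_pos hDX] at hXY
            exact hDa X Y _ ((hDm X hX hXi hDX).trans (hH.2 X (hDH X hX hDX) hXi).2) hXY hDX
          simp only [if_pos hDX, if_pos hDY] at hXY ⊢
          exact H.loc X (hDH X hX hDX) hXi Y (hDH Y hY hDY) hYi hXY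
        · have hXY' : X ∩ Iic (C.m X) = Y ∩ Iic (C.m X) := by simpa [hDX] using hXY
          have hl := C.loc X (hX.trans hA'C) hXi Y (hY.trans hA'C) hYi hXY'
          have hDY : ¬ D Y := by
            intro hDY
            have h1 := hDm Y hY hYi hDY
            rw [hl.2] at h1
            exact hDX (hDa Y X _ h1 hXY'.symm hDY)
          simp only [if_neg hDX, if_neg hDY]
          exact hl
      mem := by
        intro X hX hXi
        by_cases hDX : D X
        · simp only [if_pos hDX]; exact H.mem X (hDH X hX hDX) hXi
        · simp only [if_neg hDX]; exact C.mem X (hX.trans hA'C) hXi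
      smooth := by
        intro X hX hXi
        by_cases hDX : D X
        · simp only [if_pos hDX, if_pos (hDs X hXi hDX)]
          exact H.smooth X (hDH X hX hDX) hXi
        · have h1 := C.smooth X (hX.trans hA'C) hXi
          by_cases hDs : D (shift X)
          · simp only [if_neg hDX, if_pos hDs]
            exact h1.trans (hH.2 _ (hDH _ (hs X hX) hDs) (shift_infinite hXi)).2
          · simp only [if_neg hDX, if_neg hDs]; exact h1
      bad := by
        intro X hX hXi
        by_cases hDX : D X
        · simp only [if_pos hDX, if_pos (hDs X hXi hDX)]
          exact H.bad X (hDH X hX hDX) hXi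
        · have h1 := C.bad X (hX.trans hA'C) hXi
          by_cases hDs : D (shift X)
          · simp only [if_neg hDX, if_pos hDs]
            exact fun h => h1 (hle _ _ _ h
              (hH.2 _ (hDH _ (hs X hX) hDs) (shift_infinite hXi)).1)
          · simp only [if_neg hDX, if_neg hDs]; exact h1 }
  refine ⟨C', ⟨hA'C, fun X hX hXi => ?_⟩, ?_, fun X hX hXi hXt => ?_⟩
  · by_cases hDX : D X
    · have h1 := hH.2 X (hDH X hX hDX) hXi
      refine Or.inr ?_
      simp only [C', if_pos hDX]
      exact ⟨h1.1, hDm X hX hXi hDX, h1.2⟩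
    · refine Or.inl ?_
      simp only [C', if_neg hDX, and_self]
  · ext x
    simp only [C', A', mem_inter_iff, mem_union, mem_Iic, mem_Ioi]
    constructor
    · rintro ⟨h1 | h1, h2⟩
      · exact h1
      · omega
    · rintro ⟨h1, h2⟩; exact ⟨Or.inl ⟨h1, h2⟩, h2⟩
  · have hDX : D X := ⟨0, by rw [hXt]; ext x; simp⟩
    have h1 := C.loc X₀ h₀C hi₀ X (hX.trans hA'C) hXi hXt.symm
    simp only [C', if_pos hDX]
    rw [← h1.1]
    exact (hH.2 X (hDH X hX hDX) hXi).1

theorem exists_minAt (hwf : WellFounded lt) (htr : ∀ a b c, lt a b → lt b c → lt a c)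
    (hle : ∀ a b c, le a b → lt b c → le a c) (C : BArr le) (t : Set ℕ) (p : ℕ) :
    ∃ C' : BArr le, Ext lt p C C' ∧ C'.A ∩ Iic p = C.A ∩ Iic p ∧ MinAt lt C' t p := by
  have key : ∀ v, ∀ C : BArr le, (∃ X ⊆ C.A, X.Infinite ∧ X ∩ Iic p = t ∧ C.m X = p ∧ C.f X = v) →
      ∃ C' : BArr le, Ext lt p C C' ∧ C'.A ∩ Iic p = C.A ∩ Iic p ∧ MinAt lt C' t p := by
    intro v
    induction v using hwf.induction with
    | _ v ih =>
      rintro C ⟨X, hX, hXi, hXt, hm, hv⟩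
      by_cases hmin : MinAt lt C t p
      · exact ⟨C, Ext.refl p C, rfl, hmin⟩
      · simp only [MinAt, not_forall, not_not] at hmin
        obtain ⟨X₀, h₀C, hi₀, ht₀, hm₀, H, hH, h₀⟩ := hmin
        obtain ⟨C', hE, hA, hlt⟩ := exists_patch hle hH h₀ hi₀
        rw [hm₀] at hE hA hlt
        have hf : C.f X₀ = v := by
          rw [← hv]
          refine (C.loc X hX hXi X₀ h₀C hi₀ ?_).1
          rw [hm, hXt, ht₀]
        by_cases hex : ∃ X' ⊆ C'.A, X'.Infinite ∧ X' ∩ Iic p = t ∧ C'.m X' = p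
        · obtain ⟨X', hX', hi', ht', hm'⟩ := hex
          have h1 := hlt X' hX' hi' (ht'.trans ht₀.symm)
          rw [hf] at h1
          obtain ⟨C'', hE', hA', hM⟩ := ih _ h1 C' ⟨X', hX', hi', ht', hm', rfl⟩
          exact ⟨C'', hE.trans htr hE', hA'.trans hA, hM⟩
        · exact ⟨C', hE, hA, fun X' hX' hi' ht' hm' => absurd ⟨X', hX', hi', ht', hm'⟩ hex⟩
  by_cases hex : ∃ X ⊆ C.A, X.Infinite ∧ X ∩ Iic p = t ∧ C.m X = p
  · obtain ⟨X, h1, h2, h3, h4⟩ := hex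
    exact key _ C ⟨X, h1, h2, h3, h4, rfl⟩
  · exact ⟨C, Ext.refl p C, rfl, fun X' hX' hi' ht' hm' => absurd ⟨X', hX', hi', ht', hm'⟩ hex⟩

theorem exists_forall_minAt (hwf : WellFounded lt) (htr : ∀ a b c, lt a b → lt b c → lt a c)
    (hle : ∀ a b c, le a b → lt b c → le a c) (C : BArr le) (p : ℕ) :
    ∃ C' : BArr le, Ext lt p C C' ∧ C'.A ∩ Iic p = C.A ∩ Iic p ∧ ∀ t, MinAt lt C' t p := by
  have key : ∀ 𝒯 : Set (Set ℕ), 𝒯.Finite → ∃ C' : BArr le, Ext lt p C C' ∧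
      C'.A ∩ Iic p = C.A ∩ Iic p ∧ ∀ t ∈ 𝒯, MinAt lt C' t p := by
    intro 𝒯 h𝒯
    induction 𝒯, h𝒯 using Set.Finite.induction_on with
    | empty => exact ⟨C, Ext.refl p C, rfl, fun _ h => absurd h (notMem_empty _)⟩
    | @insert t 𝒯 _ _ ih =>
      obtain ⟨C₁, h1, h2, h3⟩ := ih
      obtain ⟨C₂, h4, h5, h6⟩ := exists_minAt hwf htr hle C₁ t p
      refine ⟨C₂, h1.trans htr h4, h5.trans h2, ?_⟩
      rintro t' (rfl | ht')
      · exact h6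
      · exact (h3 t' ht').of_ext htr h4
  obtain ⟨C', h1, h2, h3⟩ := key _ (finite_Iic p).powerset
  exact ⟨C', h1, h2, fun t X hX hi ht hm =>
    h3 t (by rw [mem_powerset_iff, ← ht]; exact inter_subset_right) X hX hi ht hm⟩

end BArr

open BArr in
/-- If every bad array has a bad array strictly below it, there is no bad array. -/
theorem isEmpty_bArr {T : Type*} {le lt : T → T → Prop} (hwf : WellFounded lt)
    (htr : ∀ a b c, lt a b → lt b c → lt a c) (hle : ∀ a b c, le a b → lt b c → le a c)
    (hdesc : ∀ C : BArr le, ∃ H, StrictBelow lt H C) (C₀ : BArr le) : False := by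
  classical
  choose st hst1 hst2 hst3 using fun C : BArr le => exists_forall_minAt hwf htr hle C
  let Cs : ℕ → BArr le := fun n =>
    Nat.rec C₀ (fun p C => if p ∈ C.A then st C p else C) n
  have hs1 : ∀ p, p ∈ (Cs p).A → Cs (p + 1) = st (Cs p) p := fun p hp => if_pos hp
  have hs2 : ∀ p, p ∉ (Cs p).A → Cs (p + 1) = Cs p := fun p hp => if_neg hp
  have hE1 : ∀ p, Ext lt p (Cs p) (Cs (p + 1)) := by
    intro p
    by_cases hp : p ∈ (Cs p).A
    · rw [hs1 p hp]; exact hst1 _ _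
    · rw [hs2 p hp]; exact Ext.refl _ _
  have hA1 : ∀ p, (Cs (p + 1)).A ∩ Iic p = (Cs p).A ∩ Iic p := by
    intro p
    by_cases hp : p ∈ (Cs p).A
    · rw [hs1 p hp]; exact hst2 _ _
    · rw [hs2 p hp]
  have hE : ∀ p j, p ≤ j → Ext lt p (Cs p) (Cs j) := by
    intro p j hj
    induction j, hj using Nat.le_induction with
    | base => exact Ext.refl _ _
    | succ j hj ih => exact ih.trans htr ((hE1 j).mono hj)
  have hA : ∀ p j, p ≤ j → p ∈ (Cs p).A → p ∈ (Cs j).A := by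
    intro p j hj hp
    induction j, hj using Nat.le_induction with
    | base => exact hp
    | succ j hj ih =>
      have : p ∈ (Cs (j + 1)).A ∩ Iic j := by rw [hA1]; exact ⟨ih, hj⟩
      exact this.1
  set A : Set ℕ := ⋂ p, (Cs p).A with hAdef
  have hAsub : ∀ p, A ⊆ (Cs p).A := fun p => iInter_subset _ p
  have hmemA : ∀ q, q ∈ (Cs q).A → q ∈ A := by
    intro q hq
    refine mem_iInter.2 fun j => ?_
    rcases le_total q j with h | h
    · exact hA q j h hq
    · exact (hE j q h).1 hq
  have hAinf : A.Infinite := by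
    refine infinite_of_forall_exists_gt fun k => ?_
    suffices h : ∃ b, k + 1 ≤ b ∧ b ∈ A from h.imp fun b hb => ⟨hb.2, hb.1⟩
    generalize k + 1 = n
    have hex : ∃ q, n ≤ q ∧ q ∈ (Cs n).A := by
      obtain ⟨q, h1, h2⟩ := (Cs n).inf.exists_gt n
      exact ⟨q, h2.le, h1⟩
    have hq := Nat.find_spec hex
    have hmin : ∀ i, n ≤ i → i < Nat.find hex → i ∉ (Cs n).A := fun i h1 h2 h3 =>
      Nat.find_min hex h2 ⟨h1, h3⟩
    revert hq hmin
    generalize Nat.find hex = q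
    intro hq hmin
    have hc : ∀ j, n ≤ j → j ≤ q → Cs j = Cs n := by
      intro j hj
      induction j, hj using Nat.le_induction with
      | base => exact fun _ => rfl
      | succ j hj ih =>
        intro hjq
        have h1 := ih (by omega)
        rw [hs2 j, h1]
        rw [h1]; exact hmin j hj hjq
    refine ⟨q, hq.1, hmemA q ?_⟩
    rw [hc q hq.1 le_rfl]; exact hq.2
  have hstab : ∀ X ⊆ A, X.Infinite → ∀ p, (Cs p).m X < p → ∀ j, p ≤ j →
      (Cs j).f X = (Cs p).f X ∧ (Cs j).m X = (Cs p).m X := by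
    intro X hX hi p hp j hj
    rcases (hE p j hj).2 X (hX.trans (hAsub j)) hi with h | h
    · exact h
    · exact absurd h.2.1 (not_le.2 hp)
  have hexst : ∀ X, X ⊆ A → X.Infinite → ∃ p, (Cs p).m X < p := by
    intro X hX hi
    have key : ∀ v p, (Cs p).f X = v → ∃ p, (Cs p).m X < p := by
      intro v
      induction v using hwf.induction with
      | _ v ih =>
        intro p hv
        rcases (hE p (max p ((Cs p).m X + 1)) (le_max_left _ _)).2 X
          (hX.trans (hAsub _)) hi with h | h
        · refine ⟨max p ((Cs p).m X + 1), ?_⟩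
          rw [h.2]; exact lt_of_lt_of_le (Nat.lt_succ_self _) (le_max_right _ _)
        · rw [hv] at h
          exact ih _ h.1 _ rfl
    exact key _ 0 rfl
  choose! P hP using hexst
  have hj : ∀ X ⊆ A, X.Infinite → ∀ j, P X ≤ j →
      (Cs (P X)).f X = (Cs j).f X ∧ (Cs (P X)).m X = (Cs j).m X := fun X hX hi j h => by
    have := hstab X hX hi _ (hP X hX hi) j h
    exact ⟨this.1.symm, this.2.symm⟩
  have hsh : ∀ X ⊆ A, shift X ⊆ A := fun X hX => (shift_subset X).trans hX
  let C : BArr le :=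
    { A := A
      inf := hAinf
      f := fun X => (Cs (P X)).f X
      m := fun X => (Cs (P X)).m X
      loc := by
        intro X hX hXi Y hY hYi h
        have h1 := hj X hX hXi (max (P X) (P Y)) (le_max_left _ _)
        have h2 := hj Y hY hYi (max (P X) (P Y)) (le_max_right _ _)
        simp only [h1.1, h1.2, h2.1, h2.2] at h ⊢
        exact (Cs _).loc X (hX.trans (hAsub _)) hXi Y (hY.trans (hAsub _)) hYi h
      mem := fun X hX hXi => (Cs _).mem X (hX.trans (hAsub _)) hXi
      smooth := by
        intro X hX hXi
        have h1 := hj X hX hXi (max (P X) (P (shift X))) (le_max_left _ _)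
        have h2 := hj _ (hsh X hX) (shift_infinite hXi) (max (P X) (P (shift X)))
          (le_max_right _ _)
        rw [h1.2, h2.2]
        exact (Cs _).smooth X (hX.trans (hAsub _)) hXi
      bad := by
        intro X hX hXi
        have h1 := hj X hX hXi (max (P X) (P (shift X))) (le_max_left _ _)
        have h2 := hj _ (hsh X hX) (shift_infinite hXi) (max (P X) (P (shift X)))
          (le_max_right _ _)
        rw [h1.1, h2.1]
        exact (Cs _).bad X (hX.trans (hAsub _)) hXi }
  have hEC : ∀ p, Ext lt p (Cs p) C := by
    intro p
    refine ⟨hAsub p, fun X hX hi => ?_⟩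
    have h1 := hj X hX hi (max (P X) p) (le_max_left _ _)
    have h2 := (hE p (max (P X) p) (le_max_right _ _)).2 X (hX.trans (hAsub _)) hi
    rw [← h1.1, ← h1.2] at h2
    exact h2
  obtain ⟨H, hH⟩ := hdesc C
  have hpm : C.m H.A ∈ H.A := C.mem _ hH.1 H.inf
  obtain ⟨p, hp⟩ : ∃ p, p = C.m H.A := ⟨_, rfl⟩
  rw [← hp] at hpm
  have hmin : MinAt lt (Cs (p + 1)) (H.A ∩ Iic p) p := by
    rw [hs1 p (hAsub p (hH.1 hpm))]; exact hst3 _ _ _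
  refine hmin H.A (hH.1.trans (hAsub (p + 1))) H.inf rfl ?_
    ⟨H, hH.of_ext htr (hEC (p + 1)), subset_rfl⟩
  rcases (hEC (p + 1)).2 H.A hH.1 H.inf with h | h
  · rw [← h.2, hp]
  · rw [← hp] at h; omega

/-! ### Terms describing germs of countable compact sets -/

/-- Terms: a point, or a point that is a limit from the sides `d` with `lab d = true` of pieces
described by `s d 0, s d 1, …`. -/
inductive Tm : Type
  | pt : Tm
  | node (lab : Bool → Bool) (s : Bool → ℕ → Tm) : Tm

namespace Tm

/-- The embeddability preorder on terms. -/
inductive le : Tm → Tm → Prop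
  | pt (t : Tm) : le pt t
  | node (lab : Bool → Bool) (s s' : Bool → ℕ → Tm) (g : Bool → ℕ → ℕ)
      (h : ∀ d i, lab d = true → le (s d i) (s' d (g d i))) : le (node lab s) (node lab s')
  | child (t : Tm) (lab : Bool → Bool) (s : Bool → ℕ → Tm) (d : Bool) (j : ℕ)
      (hd : lab d = true) (h : le t (s d j)) : le t (node lab s)

theorem le.refl (t : Tm) : le t t := by
  induction t with
  | pt => exact le.pt _
  | node lab s ih => exact le.node lab s s (fun _ i => i) fun d i _ => ih d i

theorem le.trans {a b c : Tm} (hab : le a b) (hbc : le b c) : le a c := by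
  induction hbc generalizing a with
  | pt t => cases hab; exact le.pt _
  | child t lab s d j hd _ ih => exact le.child _ lab s d j hd (ih hab)
  | node lab s s' g _ ih =>
    cases hab with
    | pt => exact le.pt _
    | node _ s₀ _ g₀ h₀ =>
      exact le.node _ _ _ (fun d i => g d (g₀ d i)) fun d i hd => ih d (g₀ d i) hd (h₀ d i hd)
    | child _ _ _ d j hd h => exact le.child _ _ _ d (g d j) hd (ih d j hd h)

/-- The labels at the root. -/
def lab : Tm → Bool → Bool
  | pt => fun _ => false
  | node l _ => l

/-- The children of the root. -/
def ch (t : Tm) : Bool → ℕ → Tm :=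
  match t with
  | pt => fun _ _ => pt
  | node _ s => s

/-- The immediate subterm relation. -/
def Sub (u t : Tm) : Prop := ∃ d j, t.lab d = true ∧ u = t.ch d j

theorem wf_sub : WellFounded Sub := by
  refine ⟨fun t => ?_⟩
  induction t with
  | pt => exact ⟨_, fun u ⟨d, j, h, _⟩ => by simp [lab] at h⟩
  | node l s ih => exact ⟨_, fun u ⟨d, j, _, h⟩ => by rw [h]; exact ih d j⟩

theorem le_of_sub {t u u' : Tm} (h : le t u) (hs : Sub u u') : le t u' := by
  obtain ⟨d, j, hd, rfl⟩ := hs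
  cases u' with
  | pt => simp [lab] at hd
  | node l s => exact le.child _ _ _ d j hd h

theorem le_of_transGen {t u u' : Tm} (h : le t u) (hs : Relation.TransGen Sub u u') : le t u' := by
  induction hs with
  | single h1 => exact le_of_sub h h1
  | tail _ h1 ih => exact le_of_sub ih h1

/-- The labels at the root, distinguishing points from nodes. -/
def root : Tm → Option (Bool → Bool)
  | pt => none
  | node l _ => some l

theorem exists_child_of_not_le {t t' : Tm} (h : ¬ le t t') (hl : t.root = t'.root) :
    ∃ d i, t.lab d = true ∧ ∀ j, ¬ le (t.ch d i) (t'.ch d j) := by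
  by_contra! hcon
  choose! g hg using hcon
  cases t with
  | pt => exact h (le.pt _)
  | node l s =>
    cases t' with
    | pt => simp [root] at hl
    | node l' s' =>
      obtain rfl : l = l' := by simpa [root] using hl
      exact h (le.node _ _ _ g fun d i hd => hg d i hd)

/-- A witness for `exists_child_of_not_le`. -/
noncomputable def pick (t t' : Tm) : Bool × ℕ :=
  open Classical in if h : ¬ le t t' ∧ t.root = t'.root then
    (⟨(exists_child_of_not_le h.1 h.2).choose,
      (exists_child_of_not_le h.1 h.2).choose_spec.choose⟩) else (true, 0)

theorem pick_spec {t t' : Tm} (h : ¬ le t t') (hl : t.root = t'.root) :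
    t.lab (pick t t').1 = true ∧
      ∀ j, ¬ le (t.ch (pick t t').1 (pick t t').2) (t'.ch (pick t t').1 j) := by
  have h' : ¬ le t t' ∧ t.root = t'.root := ⟨h, hl⟩
  simp only [pick, dif_pos h']
  exact (exists_child_of_not_le h hl).choose_spec.choose_spec

theorem exists_strictBelow (C : BArr le) :
    ∃ H, BArr.StrictBelow (Relation.TransGen Sub) H C := by
  have hsl : ∀ X ⊆ C.A, shift X ⊆ C.A := fun X hX => (shift_subset X).trans hX
  have hloc : ∀ X ⊆ C.A, X.Infinite → ∀ Y ⊆ C.A, Y.Infinite →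
      X ∩ Iic (C.m (shift X)) = Y ∩ Iic (C.m (shift X)) →
      C.f Y = C.f X ∧ C.f (shift Y) = C.f (shift X) ∧ C.m (shift Y) = C.m (shift X) := by
    intro X hX hXi Y hY hYi h
    have hm := C.smooth X hX hXi
    have h1 : X ∩ Iic (C.m X) = Y ∩ Iic (C.m X) := by
      have hs : Iic (C.m X) ⊆ Iic (C.m (shift X)) := Iic_subset_Iic.2 hm
      rw [← inter_eq_self_of_subset_right hs, ← inter_assoc, ← inter_assoc, h]
    refine ⟨(C.loc X hX hXi Y hY hYi h1).1, ?_⟩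
    exact C.loc _ (hsl X hX) (shift_infinite hXi) _ (hsl Y hY) (shift_infinite hYi)
      (shift_inter_eq hXi hYi ((Nat.sInf_le (C.mem X hX hXi)).trans hm) h)
  obtain ⟨B, hBA, hBi, k, hk⟩ := exists_homogeneous
    (fun X => ((C.f X).root, (pick (C.f X) (C.f (shift X))).1)) C.inf (fun X => C.m (shift X))
    (by
      intro X hX hXi Y hY hYi h
      obtain ⟨h1, h2, -⟩ := hloc X hX hXi Y hY hYi h
      simp only [h1, h2])
  have hsB : ∀ X ⊆ B, shift X ⊆ B := fun X hX => (shift_subset X).trans hX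
  have hroot : ∀ X ⊆ B, X.Infinite → (C.f X).root = (C.f (shift X)).root := fun X hX hi =>
    congrArg Prod.fst ((hk X hX hi).trans (hk _ (hsB X hX) (shift_infinite hi)).symm)
  have hpick : ∀ X ⊆ B, X.Infinite → (pick (C.f X) (C.f (shift X))).1 =
      (pick (C.f (shift X)) (C.f (shift (shift X)))).1 := fun X hX hi =>
    congrArg Prod.snd ((hk X hX hi).trans (hk _ (hsB X hX) (shift_infinite hi)).symm)
  refine ⟨
    { A := B
      inf := hBi
      f := fun X => (C.f X).ch (pick (C.f X) (C.f (shift X))).1 (pick (C.f X) (C.f (shift X))).2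
      m := fun X => C.m (shift X)
      loc := fun X hX hXi Y hY hYi h => by
        obtain ⟨h1, h2, h3⟩ := hloc X (hX.trans hBA) hXi Y (hY.trans hBA) hYi h
        simp only [h1, h2, h3, and_self]
      mem := fun X hX hXi =>
        shift_subset X (C.mem _ (hsl X (hX.trans hBA)) (shift_infinite hXi))
      smooth := fun X hX hXi => C.smooth _ (hsl X (hX.trans hBA)) (shift_infinite hXi)
      bad := fun X hX hXi => by
        rw [← hpick X hX hXi]
        exact (pick_spec (C.bad X (hX.trans hBA) hXi) (hroot X hX hXi)).2 _ },
    hBA, fun X hX hXi => ⟨Relation.TransGen.single ⟨_, _,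
      (pick_spec (C.bad X (hX.trans hBA) hXi) (hroot X hX hXi)).1, rfl⟩,
      C.smooth X (hX.trans hBA) hXi⟩⟩

/-- Terms are well-quasi-ordered by `le`. -/
theorem exists_lt_le (f : ℕ → Tm) : ∃ i j, i < j ∧ le (f i) (f j) := by
  by_contra! hcon
  have hsh : ∀ X : Set ℕ, X.Infinite → sInf X < sInf (shift X) := fun X hX => by
    have h1 := Nat.sInf_mem (shift_infinite hX).nonempty
    exact lt_of_le_of_ne (Nat.sInf_le h1.1) fun h => h1.2 h.symm
  refine isEmpty_bArr (le := le) wf_sub.transGen (fun _ _ _ h1 h2 => h1.trans h2)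
    (fun a b c h1 h2 => le_of_transGen h1 h2) exists_strictBelow
    { A := univ
      inf := infinite_univ
      f := fun X => f (sInf X)
      m := fun X => sInf X
      loc := fun X _ hX Y _ hY h => ?_
      mem := fun X _ hX => Nat.sInf_mem hX.nonempty
      smooth := fun X _ hX => (hsh X hX).le
      bad := fun X _ hX => hcon (sInf X) (sInf (shift X)) (hsh X hX) }
  have h : X ∩ Iic (sInf X) = Y ∩ Iic (sInf X) := h
  have h1 : sInf X ∈ Y ∩ Iic (sInf X) := h ▸ ⟨Nat.sInf_mem hX.nonempty, mem_Iic.2 le_rfl⟩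
  have h2 : sInf Y ∈ X ∩ Iic (sInf X) := h.symm ▸
    ⟨Nat.sInf_mem hY.nonempty, (Nat.sInf_le h1.1 : sInf Y ≤ sInf X)⟩
  have : sInf Y = sInf X := le_antisymm (Nat.sInf_le h1.1) (Nat.sInf_le h2.1)
  simp only [this, and_self]

end Tm

/-! ### Continuous strictly monotone embeddings -/

/-- `h` is a continuous strictly monotone map from `K` to `L`. -/
def IsEmb (h : ℝ → ℝ) (K L : Set ℝ) : Prop :=
  MapsTo h K L ∧ StrictMonoOn h K ∧ ContinuousOn h K

/-- `K` embeds into `L`. -/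
def Emb (K L : Set ℝ) : Prop := ∃ h, IsEmb h K L

/-- `K` embeds into `L` with `x` sent to `y`. -/
def EmbPt (K : Set ℝ) (x : ℝ) (L : Set ℝ) (y : ℝ) : Prop := ∃ h, IsEmb h K L ∧ h x = y

theorem IsEmb.mono {h : ℝ → ℝ} {K K' L L' : Set ℝ} (hh : IsEmb h K L) (hK : K' ⊆ K)
    (hL : L ⊆ L') : IsEmb h K' L' :=
  ⟨fun _ hx => hL (hh.1 (hK hx)), hh.2.1.mono hK, hh.2.2.mono hK⟩

theorem Emb.mono {K K' L L' : Set ℝ} (hh : Emb K L) (hK : K' ⊆ K) (hL : L ⊆ L') : Emb K' L' :=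
  let ⟨h, hh⟩ := hh
  ⟨h, hh.mono hK hL⟩

theorem Emb.empty (L : Set ℝ) : Emb ∅ L :=
  ⟨id, fun _ h => absurd h (notMem_empty _), fun _ h => absurd h (notMem_empty _),
    continuousOn_empty _⟩

theorem EmbPt.emb {K L : Set ℝ} {x y : ℝ} (h : EmbPt K x L y) : Emb K L :=
  let ⟨h, hh, _⟩ := h
  ⟨h, hh⟩

theorem EmbPt.singleton {L : Set ℝ} (x : ℝ) {y : ℝ} (hy : y ∈ L) : EmbPt {x} x L y :=
  ⟨fun _ => y, ⟨fun _ _ => hy, fun a ha b hb hab => by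
    rw [mem_singleton_iff] at ha hb; subst ha hb; exact absurd hab (lt_irrefl _),
    continuousOn_const⟩, rfl⟩

theorem continuousOn_cut {K : Set ℝ} {a : ℝ} {h₁ h₂ : ℝ → ℝ} (ha : a ∉ K)
    (hh₁ : ContinuousOn h₁ (K ∩ Iio a)) (hh₂ : ContinuousOn h₂ (K ∩ Ioi a)) :
    ContinuousOn (fun z => if z < a then h₁ z else h₂ z) K := by
  refine ContinuousOn.if ?_ ?_ ?_
  · rintro z ⟨hz, hz'⟩
    have : z ∈ frontier (Iio a) := hz'
    rw [frontier_Iio, mem_singleton_iff] at this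
    exact absurd (this ▸ hz) ha
  · refine hh₁.mono ?_
    rintro z ⟨hz, hz'⟩
    have h : z ∈ closure (Iio a) := hz'
    rw [closure_Iio] at h
    have hne : z ≠ a := fun h => ha (h ▸ hz)
    exact ⟨hz, lt_of_le_of_ne h hne⟩
  · refine hh₂.mono ?_
    rintro z ⟨hz, hz'⟩
    have h : z ∈ closure {z | ¬ z < a} := hz'
    simp only [not_lt] at h
    rw [show {z | a ≤ z} = Ici a from rfl, closure_Ici] at h
    exact ⟨hz, lt_of_le_of_ne h fun e : a = z => ha (e ▸ hz)⟩

theorem IsEmb.glue_cut {K L₁ L₂ : Set ℝ} {a : ℝ} {h₁ h₂ : ℝ → ℝ} (ha : a ∉ K)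
    (hh₁ : IsEmb h₁ (K ∩ Iio a) L₁) (hh₂ : IsEmb h₂ (K ∩ Ioi a) L₂)
    (hL : ∀ x ∈ L₁, ∀ y ∈ L₂, x < y) :
    IsEmb (fun z => if z < a then h₁ z else h₂ z) K (L₁ ∪ L₂) := by
  have hgt : ∀ z ∈ K, ¬ z < a → z ∈ K ∩ Ioi a := fun z hz h =>
    ⟨hz, lt_of_le_of_ne (not_lt.1 h) fun h => ha (by rwa [h])⟩
  refine ⟨fun z hz => ?_, fun z hz w hw hzw => ?_, ?_⟩
  · by_cases h : z < a
    · simp only [if_pos h]; exact Or.inl (hh₁.1 ⟨hz, h⟩)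
    · simp only [if_neg h]; exact Or.inr (hh₂.1 (hgt z hz h))
  · by_cases h : z < a <;> by_cases h' : w < a
    · simp only [if_pos h, if_pos h']; exact hh₁.2.1 ⟨hz, h⟩ ⟨hw, h'⟩ hzw
    · simp only [if_pos h, if_neg h']
      exact hL _ (hh₁.1 ⟨hz, h⟩) _ (hh₂.1 (hgt w hw h'))
    · exact absurd (hzw.trans h') h
    · simp only [if_neg h, if_neg h']; exact hh₂.2.1 (hgt z hz h) (hgt w hw h') hzw
  · exact continuousOn_cut ha hh₁.2.2 hh₂.2.2

theorem EmbPt.glue {K L : Set ℝ} {x y : ℝ} (hx : x ∈ K) (h₁ : EmbPt (K ∩ Iic x) x (L ∩ Iic y) y)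
    (h₂ : EmbPt (K ∩ Ici x) x (L ∩ Ici y) y) : EmbPt K x L y := by
  obtain ⟨f, hf, hfx⟩ := h₁
  obtain ⟨g, hg, hgx⟩ := h₂
  refine ⟨fun z => if z ≤ x then f z else g z, ⟨fun z hz => ?_, fun z hz w hw hzw => ?_, ?_⟩, ?_⟩
  · by_cases h : z ≤ x
    · simp only [if_pos h]; exact (hf.1 ⟨hz, h⟩).1
    · simp only [if_neg h]; exact (hg.1 ⟨hz, (not_le.1 h).le⟩).1
  · by_cases h : z ≤ x <;> by_cases h' : w ≤ x
    · simp only [if_pos h, if_pos h']; exact hf.2.1 ⟨hz, h⟩ ⟨hw, h'⟩ hzw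
    · simp only [if_pos h, if_neg h']
      have hw' : w ∈ K ∩ Ici x := ⟨hw, (not_le.1 h').le⟩
      exact (hf.1 ⟨hz, h⟩).2.trans_lt (hgx ▸ hg.2.1 ⟨hx, le_refl x⟩ hw' (not_le.1 h'))
    · exact absurd (hzw.le.trans h') h
    · simp only [if_neg h, if_neg h']
      exact hg.2.1 ⟨hz, (not_le.1 h).le⟩ ⟨hw, (not_le.1 h').le⟩ hzw
  · refine ContinuousOn.if ?_ ?_ ?_
    · rintro z ⟨hz, hz'⟩
      have : z ∈ frontier (Iic x) := hz'
      rw [frontier_Iic, mem_singleton_iff] at this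
      rw [this, hfx, hgx]
    · refine hf.2.2.mono ?_
      rintro z ⟨hz, hz'⟩
      have h : z ∈ closure (Iic x) := hz'
      rw [closure_Iic] at h
      exact ⟨hz, h⟩
    · refine hg.2.2.mono ?_
      rintro z ⟨hz, hz'⟩
      have h : z ∈ closure {z | ¬ z ≤ x} := hz'
      simp only [not_le] at h
      rw [show {z | x < z} = Ioi x from rfl, closure_Ioi] at h
      exact ⟨hz, h⟩
  · simp [hfx]

/-- Reflection of the line for `d = false`, the identity for `d = true`. -/
def sg (d : Bool) (x : ℝ) : ℝ := if d then x else -x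

theorem sg_sg (d : Bool) (x : ℝ) : sg d (sg d x) = x := by cases d <;> simp [sg]

theorem continuous_sg (d : Bool) : Continuous (sg d) := by
  cases d
  · exact continuous_neg.congr fun x => by simp [sg]
  · exact continuous_id.congr fun x => by simp [sg]

/-- The image of `K` under `sg d`. -/
def rfx (d : Bool) (K : Set ℝ) : Set ℝ := sg d ⁻¹' K

theorem mem_rfx {d : Bool} {K : Set ℝ} {x : ℝ} : x ∈ rfx d K ↔ sg d x ∈ K := Iff.rfl

theorem rfx_rfx (d : Bool) (K : Set ℝ) : rfx d (rfx d K) = K := by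
  ext x; simp [mem_rfx, sg_sg]

theorem rfx_inter (d : Bool) (K L : Set ℝ) : rfx d (K ∩ L) = rfx d K ∩ rfx d L := rfl

theorem rfx_mono (d : Bool) {K L : Set ℝ} (h : K ⊆ L) : rfx d K ⊆ rfx d L := preimage_mono h

@[simp] theorem rfx_true (K : Set ℝ) : rfx true K = K := by ext x; simp [mem_rfx, sg]

theorem rfx_false_Ioo (a b : ℝ) : rfx false (Ioo a b) = Ioo (-b) (-a) := by
  ext x; simp only [mem_rfx, sg, mem_Ioo]; constructor <;> intro h <;> simp at h ⊢ <;>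
    constructor <;> linarith

theorem rfx_false_Iio (a : ℝ) : rfx false (Iio a) = Ioi (-a) := by
  ext x; simp [mem_rfx, sg, neg_lt]

theorem rfx_false_Ioi (a : ℝ) : rfx false (Ioi a) = Iio (-a) := by
  ext x; simp [mem_rfx, sg, lt_neg]

theorem rfx_false_Ici (a : ℝ) : rfx false (Ici a) = Iic (-a) := by
  ext x; simp [mem_rfx, sg, le_neg]

theorem IsEmb.rfx {h : ℝ → ℝ} {K L : Set ℝ} (d : Bool) (hh : IsEmb h K L) :
    IsEmb (fun z => sg d (h (sg d z))) (rfx d K) (rfx d L) := by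
  refine ⟨fun z hz => ?_, fun z hz w hw hzw => ?_, ?_⟩
  · rw [mem_rfx, sg_sg]; exact hh.1 hz
  · cases d
    · simp only [sg, Bool.false_eq_true, if_false, neg_lt_neg_iff]
      have hz' : -z ∈ K := by simpa [mem_rfx, sg] using hz
      have hw' : -w ∈ K := by simpa [mem_rfx, sg] using hw
      exact hh.2.1 hw' hz' (neg_lt_neg hzw)
    · rw [rfx_true] at hz hw
      simpa [sg] using hh.2.1 hz hw hzw
  · exact (continuous_sg d).comp_continuousOn
      (hh.2.2.comp (continuous_sg d).continuousOn fun z hz => hz)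

theorem Emb.rfx {K L : Set ℝ} (d : Bool) (hh : Emb K L) : Emb (rfx d K) (rfx d L) :=
  let ⟨_, hh⟩ := hh
  ⟨_, hh.rfx d⟩

theorem Emb.of_rfx {K L : Set ℝ} (d : Bool)
    (hh : Emb (GodelCount.rfx d K) (GodelCount.rfx d L)) : Emb K L := by
  simpa only [rfx_rfx] using hh.rfx d

theorem EmbPt.of_rfx {K L : Set ℝ} {x y : ℝ} (d : Bool)
    (hh : EmbPt (GodelCount.rfx d K) (sg d x) (GodelCount.rfx d L) (sg d y)) : EmbPt K x L y := by
  obtain ⟨h, hh, hx⟩ := hh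
  refine ⟨fun z => sg d (h (sg d z)), ?_, by simp only [hx, sg_sg]⟩
  simpa only [rfx_rfx] using hh.rfx d

theorem exists_mem_Ioo_of_tendsto {c : ℕ → ℝ} {x z : ℝ}
    (hcx : Filter.Tendsto c Filter.atTop (nhds x)) (h0 : c 0 < z) (hz : z < x)
    (hne : ∀ i, c i ≠ z) : ∃ n, z ∈ Ioo (c n) (c (n + 1)) := by
  have hex : ∃ n, z < c n := (hcx.eventually_const_lt hz).exists
  classical
  have h1 := Nat.find_spec hex
  have h2 : ∀ i < Nat.find hex, ¬ z < c i := fun i => Nat.find_min hex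
  revert h1 h2
  generalize Nat.find hex = n
  intro h1 h2
  cases n with
  | zero => exact absurd h1 (not_lt.2 h0.le)
  | succ n => exact ⟨n, lt_of_le_of_ne (not_lt.1 (h2 n n.lt_succ_self)) (hne n), h1⟩

/-- Infinitely many consecutive embeddings converging to a point. -/
theorem embPt_of_tendsto {K K' : Set ℝ} {x x' : ℝ} (c : ℕ → ℝ) (hc : StrictMono c)
    (hcx : Filter.Tendsto c Filter.atTop (nhds x)) (hcK : ∀ i, c i ∉ K)
    (h0 : K ∩ Iio x ⊆ Ioi (c 0)) (hx' : x' ∈ K')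
    (H : ∀ i, ∀ y < x', ∃ y' < x', y < y' ∧ Emb (K ∩ Ioo (c i) (c (i + 1))) (K' ∩ Ioo y y')) :
    EmbPt (K ∩ Iic x) x (K' ∩ Iic x') x' := by
  have hcx' : ∀ i, c i < x := fun i =>
    lt_of_lt_of_le (hc (Nat.lt_succ_self i)) (hc.monotone.ge_of_tendsto hcx (i + 1))
  have H' : ∀ (i : ℕ) (y : {y // y < x'}), ∃ y' : {y // y < x'}, y.1 < y'.1 ∧
      x' - 1 / (i + 1) < y'.1 ∧
      ∃ h, IsEmb h (K ∩ Ioo (c i) (c (i + 1))) (K' ∩ Ioo y.1 y'.1) := by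
    rintro i ⟨y, hy⟩
    have hpos : (0 : ℝ) < 1 / (i + 1) := by positivity
    obtain ⟨y', h1, h2, h3⟩ := H i (max y (x' - 1 / (i + 1))) (max_lt hy (by linarith))
    exact ⟨⟨y', h1⟩, lt_of_le_of_lt (le_max_left _ _) h2, lt_of_le_of_lt (le_max_right _ _) h2,
      h3.mono subset_rfl (inter_subset_inter_right _ (Ioo_subset_Ioo_left (le_max_left _ _)))⟩
  choose nxt hn1 hn2 hn3 using H'
  let y : ℕ → {y // y < x'} := fun n => Nat.rec ⟨x' - 1, by linarith⟩ (fun i y => nxt i y) n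
  have hy1 : ∀ n, (y n).1 < (y (n + 1)).1 := fun n => hn1 n (y n)
  have hy2 : ∀ n : ℕ, x' - 1 / (n + 1) < (y (n + 1)).1 := fun n => hn2 n (y n)
  have hy3 : ∀ n, ∃ h, IsEmb h (K ∩ Ioo (c n) (c (n + 1))) (K' ∩ Ioo (y n).1 (y (n + 1)).1) :=
    fun n => hn3 n (y n)
  choose h hh using hy3
  have hym : StrictMono fun n => (y n).1 := strictMono_nat_of_lt_succ hy1
  have hN : ∀ z, z ∈ K ∩ Iio x → ∃ n, z ∈ Ioo (c n) (c (n + 1)) := by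
    rintro z ⟨hzK, hzx⟩
    exact exists_mem_Ioo_of_tendsto hcx (h0 ⟨hzK, hzx⟩) hzx fun i h => hcK i (h ▸ hzK)
  choose! N hN using hN
  have hNu : ∀ n, ∀ z ∈ K ∩ Iio x, z ∈ Ioo (c n) (c (n + 1)) → N z = n := by
    intro n z hz hzn
    have h1 := hN z hz
    have h2 := hc.lt_iff_lt.1 (h1.1.trans hzn.2)
    have h3 := hc.lt_iff_lt.1 (hzn.1.trans h1.2)
    omega
  have hval : ∀ z ∈ K ∩ Iio x, h (N z) z ∈ K' ∩ Ioo (y (N z)).1 (y (N z + 1)).1 :=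
    fun z hz => (hh (N z)).1 ⟨hz.1, hN z hz⟩
  refine ⟨fun z => if z < x then h (N z) z else x', ⟨?_, ?_, ?_⟩, by simp⟩
  · rintro z ⟨hz, hzx⟩
    by_cases hlt : z < x
    · simp only [if_pos hlt]
      have := hval z ⟨hz, hlt⟩
      exact ⟨this.1, (this.2.2.trans (y (_ + 1)).2).le⟩
    · simp only [if_neg hlt]
      exact ⟨hx', le_refl x'⟩
  · rintro z ⟨hz, hzx⟩ w ⟨hw, hwx⟩ hzw
    have hzlt : z < x := lt_of_lt_of_le hzw hwx
    have h1 := hval z ⟨hz, hzlt⟩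
    simp only [if_pos hzlt]
    by_cases hwlt : w < x
    · simp only [if_pos hwlt]
      have h2 := hval w ⟨hw, hwlt⟩
      have h3 := hN z ⟨hz, hzlt⟩
      have h4 := hN w ⟨hw, hwlt⟩
      have h5 : N z < N w + 1 := hc.lt_iff_lt.1 (h3.1.trans (hzw.trans h4.2))
      rcases (Nat.lt_succ_iff.1 h5).eq_or_lt with h6 | h6
      · rw [h6] at h3 ⊢
        exact (hh (N w)).2.1 ⟨hz, h3⟩ ⟨hw, h4⟩ hzw
      · exact h1.2.2.trans_le ((hym.monotone h6).trans h2.2.1.le)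
    · simp only [if_neg hwlt]
      exact h1.2.2.trans (y (_ + 1)).2
  · rintro z ⟨hz, hzx⟩
    rcases (show z ≤ x from hzx).eq_or_lt with rfl | hlt
    · rw [ContinuousWithinAt]
      simp only [lt_irrefl, if_false]
      refine tendsto_order.2 ⟨fun a ha => ?_, fun a ha => ?_⟩
      · obtain ⟨n, hn⟩ := exists_nat_one_div_lt (sub_pos.2 ha)
        filter_upwards [self_mem_nhdsWithin, mem_nhdsWithin_of_mem_nhds
          (Ioi_mem_nhds (hcx' (n + 1)))] with w hw hwc
        by_cases hwlt : w < z
        · simp only [if_pos hwlt]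
          have h2 := (hval w ⟨hw.1, hwlt⟩).2.1
          have h4 := hN w ⟨hw.1, hwlt⟩
          have h5 : n + 1 < N w + 1 := hc.lt_iff_lt.1 (lt_trans hwc h4.2)
          have h6 := hym.monotone (show n + 1 ≤ N w by omega)
          have h7 := hy2 n
          linarith
        · simp only [if_neg hwlt]; exact ha
      · filter_upwards [self_mem_nhdsWithin] with w hw
        by_cases hwlt : w < z
        · simp only [if_pos hwlt]
          exact ((hval w ⟨hw.1, hwlt⟩).2.2.trans (y (_ + 1)).2).trans ha
        · simp only [if_neg hwlt]; exact ha
    · have h1 := hN z ⟨hz, hlt⟩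
      have hnb : Ioo (c (N z)) (c (N z + 1)) ∈ nhds z := Ioo_mem_nhds h1.1 h1.2
      have hcont : ContinuousWithinAt (h (N z)) (K ∩ Ioo (c (N z)) (c (N z + 1))) z :=
        (hh (N z)).2.2 z ⟨hz, h1⟩
      rw [continuousWithinAt_inter hnb] at hcont
      refine (hcont.mono inter_subset_left).congr_of_eventuallyEq ?_ ?_
      · filter_upwards [self_mem_nhdsWithin, mem_nhdsWithin_of_mem_nhds hnb] with w hw hwc
        have hwlt : w < x := hwc.2.trans (hcx' _)
        simp only [if_pos hwlt]
        rw [hNu _ w ⟨hw.1, hwlt⟩ hwc]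
      · simp only [if_pos hlt]

/-! ### Finite sums -/

/-- `K` is cut at finitely many points outside `K` into consecutive pieces having the listed
properties. -/
def SumOf {ι : Type*} (P : ι → Set ℝ → Prop) : List ι → Set ℝ → Prop
  | [], K => K = ∅
  | i :: l, K => ∃ a, a ∉ K ∧ P i (K ∩ Iio a) ∧ SumOf P l (K ∩ Ioi a)

section SumOf

variable {ι κ : Type*} {P : ι → Set ℝ → Prop} {Q : κ → Set ℝ → Prop}

theorem SumOf.exists_piece {l : List ι} {K : Set ℝ} (h : SumOf P l K) {i : ι} (hi : i ∈ l) :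
    ∃ B ⊆ K, P i B := by
  induction l generalizing K with
  | nil => simp at hi
  | cons j l ih =>
    obtain ⟨a, -, h1, h2⟩ := h
    rcases List.mem_cons.1 hi with rfl | hi
    · exact ⟨_, inter_subset_left, h1⟩
    · obtain ⟨B, hB, hP⟩ := ih h2 hi
      exact ⟨B, hB.trans inter_subset_left, hP⟩

theorem SumOf.map {l : List ι} {K : Set ℝ} (h : SumOf P l K)
    (hPQ : ∀ i ∈ l, ∃ j, ∀ B, P i B → Q j B) : ∃ l', SumOf Q l' K := by
  induction l generalizing K with
  | nil => exact ⟨[], h⟩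
  | cons i l ih =>
    obtain ⟨a, ha, h1, h2⟩ := h
    obtain ⟨l', hl'⟩ := ih h2 fun i hi => hPQ i (List.mem_cons_of_mem _ hi)
    obtain ⟨j, hj⟩ := hPQ i List.mem_cons_self
    exact ⟨j :: l', a, ha, hj _ h1, hl'⟩

theorem SumOf.append {l₁ l₂ : List ι} {K : Set ℝ} {b : ℝ} (hb : b ∉ K)
    (h₁ : SumOf P l₁ (K ∩ Iio b)) (h₂ : SumOf P l₂ (K ∩ Ioi b)) : SumOf P (l₁ ++ l₂) K := by
  induction l₁ generalizing K b with
  | nil =>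
    have h₁ : K ∩ Iio b = ∅ := h₁
    have : K ∩ Ioi b = K := by
      refine inter_eq_left.2 fun x hx => ?_
      rcases lt_trichotomy x b with h | h | h
      · exact absurd (show x ∈ K ∩ Iio b from ⟨hx, h⟩) (h₁ ▸ notMem_empty _)
      · exact absurd (h ▸ hx) hb
      · exact h
    rwa [this] at h₂
  | cons i l ih =>
    obtain ⟨a, ha, h3, h4⟩ := h₁
    rcases lt_or_ge a b with hab | hab
    · refine ⟨a, fun h => ha ⟨h, hab⟩, ?_, ih (b := b) (fun h => hb h.1) ?_ ?_⟩
      · rwa [inter_assoc, inter_comm (Iio b), ← inter_assoc,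
          inter_eq_left.2 (show K ∩ Iio a ⊆ Iio b from fun x hx => lt_trans hx.2 hab)] at h3
      · rwa [inter_right_comm]
      · rwa [inter_right_comm, inter_eq_left.2
          (show K ∩ Ioi b ⊆ Ioi a from fun x hx => lt_trans hab hx.2)]
    · refine ⟨b, hb, ?_, ih (b := b) (fun h => hb h.1) ?_ ?_⟩
      · rwa [inter_eq_left.2
          (show K ∩ Iio b ⊆ Iio a from fun x hx => lt_of_lt_of_le hx.2 hab)] at h3
      · have e1 : K ∩ Iio b ∩ Ioi a = ∅ := by
          ext x; simp only [mem_inter_iff, mem_Iio, mem_Ioi, mem_empty_iff_false, iff_false]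
          rintro ⟨⟨-, h1⟩, h2⟩; linarith
        have e2 : K ∩ Ioi b ∩ Iio b = ∅ := by
          ext x; simp only [mem_inter_iff, mem_Iio, mem_Ioi, mem_empty_iff_false, iff_false]
          rintro ⟨⟨-, h1⟩, h2⟩; linarith
        rwa [e2, ← e1]
      · rwa [inter_assoc, inter_self]

theorem SumOf.singleton {K : Set ℝ} {i : ι} {M : ℝ} (h : P i K) (hK : K ⊆ Iio M) :
    SumOf P [i] K := by
  refine ⟨M, fun h => lt_irrefl M (hK h), ?_, ?_⟩
  · rwa [inter_eq_left.2 hK]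
  · ext x; simp only [mem_inter_iff, mem_Ioi, mem_empty_iff_false, iff_false]
    rintro ⟨h1, h2⟩
    exact lt_asymm h2 (hK h1)

theorem SumOf.rfx_false {l : List ι} {K : Set ℝ} {m : ℝ} (h : SumOf P l K) (hK : K ⊆ Ioi m) :
    SumOf (fun i B => P i (rfx false B)) l.reverse (rfx false K) := by
  induction l generalizing K m with
  | nil =>
    have h : K = ∅ := h
    subst h; rfl
  | cons i l ih =>
    obtain ⟨a, ha, h1, h2⟩ := h
    rw [List.reverse_cons]
    refine SumOf.append (b := -a) (by simpa [mem_rfx, sg] using ha) ?_ ?_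
    · rw [← rfx_false_Ioi, ← rfx_inter]
      exact ih h2 (inter_subset_right)
    · rw [← rfx_false_Iio, ← rfx_inter]
      refine SumOf.singleton (M := -m) (by rwa [rfx_rfx]) ?_
      rw [← rfx_false_Ioi]
      exact rfx_mono _ (inter_subset_left.trans hK)

theorem SumOf.emb {l : List ι} {K K' : Set ℝ} {x' : ℝ} (h : SumOf P l K)
    (H : ∀ i ∈ l, ∀ A, P i A → ∀ y < x', ∃ y' < x', y < y' ∧ Emb A (K' ∩ Ioo y y')) :
    ∀ y < x', ∃ y' < x', y < y' ∧ Emb K (K' ∩ Ioo y y') := by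
  induction l generalizing K with
  | nil =>
    intro y hy
    obtain ⟨y', h1, h2⟩ := exists_between hy
    have h : K = ∅ := h
    exact ⟨y', h2, h1, h ▸ Emb.empty _⟩
  | cons i l ih =>
    intro y hy
    obtain ⟨a, ha, h1, h2⟩ := h
    obtain ⟨y₁, h3, h4, f, hf⟩ := H i List.mem_cons_self _ h1 y hy
    obtain ⟨y₂, h5, h6, g, hg⟩ := ih h2 (fun i hi => H i (List.mem_cons_of_mem _ hi)) y₁ h3
    refine ⟨y₂, h5, h4.trans h6, _, (hf.glue_cut ha hg ?_).mono subset_rfl ?_⟩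
    · exact fun z hz w hw => hz.2.2.trans hw.2.1
    · refine union_subset (inter_subset_inter_right _ ?_) (inter_subset_inter_right _ ?_)
      · exact Ioo_subset_Ioo_right h6.le
      · exact Ioo_subset_Ioo_left h4.le

theorem SumOf.emb_of_sublistForall₂ {R : ι → κ → Prop}
    (H : ∀ i j A B, R i j → P i A → Q j B → Emb A B) {l : List ι} {l' : List κ}
    (hl : List.SublistForall₂ R l l') {K K' : Set ℝ} (h : SumOf P l K) (h' : SumOf Q l' K') :
    Emb K K' := by
  induction hl generalizing K K' with
  | nil =>
    have h : K = ∅ := h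
    exact h ▸ Emb.empty _
  | cons hR _ ih =>
    obtain ⟨a, ha, h1, h2⟩ := h
    obtain ⟨b, hb, h3, h4⟩ := h'
    obtain ⟨f, hf⟩ := H _ _ _ _ hR h1 h3
    obtain ⟨g, hg⟩ := ih h2 h4
    exact ⟨_, (hf.glue_cut ha hg fun z hz w hw => lt_trans hz.2 hw.2).mono subset_rfl
      (union_subset inter_subset_left inter_subset_left)⟩
  | cons_right _ ih =>
    obtain ⟨b, hb, h3, h4⟩ := h'
    exact (ih h h4).mono subset_rfl inter_subset_left

end SumOf

/-! ### Realizations of terms -/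

/-- Left of `x`, `K` is an infinite sum, converging to `x`, of finite sums of pieces
satisfying some `P j`. -/
def LowHalf (P : ℕ → Set ℝ → Prop) (K : Set ℝ) (x : ℝ) : Prop :=
  ∃ c : ℕ → ℝ, StrictMono c ∧ Filter.Tendsto c Filter.atTop (nhds x) ∧ (∀ i, c i ∉ K) ∧
    K ∩ Iio x ⊆ Ioi (c 0) ∧ ∀ i, ∃ l, SumOf P l (K ∩ Ioo (c i) (c (i + 1)))

theorem LowHalf.embPt {P : ℕ → Set ℝ → Prop} {K K' : Set ℝ} {x x' : ℝ} (h : LowHalf P K x)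
    (hx' : x' ∈ K')
    (H : ∀ j A, P j A → ∀ y < x', ∃ y' < x', y < y' ∧ Emb A (K' ∩ Ioo y y')) :
    EmbPt (K ∩ Iic x) x (K' ∩ Iic x') x' := by
  obtain ⟨c, h1, h2, h3, h4, h5⟩ := h
  refine embPt_of_tendsto c h1 h2 h3 h4 hx' fun i => ?_
  obtain ⟨l, hl⟩ := h5 i
  exact hl.emb fun j _ => H j

/-- `A` is, around `x`, at most as complicated as described by the term. -/
def LowAt : Tm → Set ℝ → ℝ → Prop
  | .pt, A, x => A = {x}
  | .node lab s, A, x => x ∈ A ∧ ∀ d, if lab d = true then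
      LowHalf (fun j B => ∃ y, LowAt (s d j) (rfx d B) y) (rfx d A) (sg d x)
      else rfx d A ∩ Iio (sg d x) = ∅

/-- `A` is at most as complicated as described by the term. -/
def Low (t : Tm) (A : Set ℝ) : Prop := ∃ x, LowAt t A x

/-- On side `d`, every piece of lower type embeds arbitrarily close to `x` in `B`. -/
def HighHalf (d : Bool) (s : ℕ → Tm) (B : Set ℝ) (x : ℝ) : Prop :=
  ∀ j, ∀ y < sg d x, ∃ y' < sg d x, y < y' ∧ ∀ u A, Tm.le u (s j) → Low u A →
    Emb (rfx d A) (rfx d B ∩ Ioo y y')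

/-- `B` is, around `x`, at least as complicated as described by the term. -/
def HighAt (t : Tm) (B : Set ℝ) (x : ℝ) : Prop :=
  x ∈ B ∧ ∀ d, t.lab d = true → HighHalf d (t.ch d) B x

/-- Pointed comparison of terms. -/
inductive Tm.gle : Tm → Tm → Prop
  | pt (t : Tm) : gle pt t
  | node (lab : Bool → Bool) (s s' : Bool → ℕ → Tm) (g : Bool → ℕ → ℕ)
      (h : ∀ d i, lab d = true → le (s d i) (s' d (g d i))) : gle (node lab s) (node lab s')

theorem embPt_half {d : Bool} {s s' : ℕ → Tm} {g : ℕ → ℕ} (hg : ∀ i, Tm.le (s i) (s' (g i)))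
    {A B : Set ℝ} {x y : ℝ}
    (hA : LowHalf (fun j B => ∃ y, LowAt (s j) (rfx d B) y) (rfx d A) (sg d x))
    (hy : y ∈ B) (hB : HighHalf d s' B y) :
    EmbPt (rfx d A ∩ Iic (sg d x)) (sg d x) (rfx d B ∩ Iic (sg d y)) (sg d y) := by
  refine hA.embPt (by rwa [mem_rfx, sg_sg]) fun j C hC z hz => ?_
  obtain ⟨z', h1, h2, h3⟩ := hB (g j) z hz
  refine ⟨z', h1, h2, ?_⟩
  simpa only [rfx_rfx] using h3 _ _ (hg j) hC

theorem embPt_of_gle {t t' : Tm} (h : t.gle t') {A B : Set ℝ} {x y : ℝ} (hA : LowAt t A x)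
    (hB : HighAt t' B y) : EmbPt A x B y := by
  cases h with
  | pt =>
    have hA : A = {x} := hA
    rw [hA]
    exact EmbPt.singleton x hB.1
  | node lab s s' g hg =>
    have key : ∀ d, EmbPt (rfx d A ∩ Iic (sg d x)) (sg d x)
        (rfx d B ∩ Iic (sg d y)) (sg d y) := by
      intro d
      have h1 := hA.2 d
      by_cases hd : lab d = true
      · rw [if_pos hd] at h1
        exact embPt_half (fun i => hg d i hd) h1 hB.1 (hB.2 d hd)
      · rw [if_neg hd] at h1
        have h2 : rfx d A ∩ Iic (sg d x) = {sg d x} := by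
          ext z
          simp only [mem_inter_iff, mem_Iic, mem_singleton_iff]
          constructor
          · rintro ⟨h2, h3⟩
            rcases h3.eq_or_lt with h4 | h4
            · exact h4
            · exact absurd (show z ∈ rfx d A ∩ Iio (sg d x) from ⟨h2, h4⟩)
                (h1 ▸ notMem_empty _)
          · rintro rfl
            exact ⟨by rw [mem_rfx, sg_sg]; exact hA.1, le_rfl⟩
        rw [h2]
        exact EmbPt.singleton _ ⟨by rw [mem_rfx, sg_sg]; exact hB.1, mem_Iic.2 le_rfl⟩
    refine EmbPt.glue hA.1 ?_ ?_
    · simpa only [rfx_true, sg, if_true] using key true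
    · refine EmbPt.of_rfx false ?_
      have := key false
      rw [rfx_inter, rfx_inter, rfx_false_Ici, rfx_false_Ici]
      simpa [sg] using this

theorem emb_of_le {t t' : Tm} (h : t.le t') {A B : Set ℝ} {y : ℝ} (hA : Low t A)
    (hB : HighAt t' B y) : Emb A B := by
  obtain ⟨x, hx⟩ := hA
  cases h with
  | pt => exact (embPt_of_gle (Tm.gle.pt t') hx hB).emb
  | node lab s s' g hg => exact (embPt_of_gle (Tm.gle.node lab s s' g hg) hx hB).emb
  | child _ lab s d j hd h =>
    obtain ⟨y', -, -, h3⟩ := hB.2 d hd j (sg d y - 1) (by linarith)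
    exact Emb.of_rfx d ((h3 t A h ⟨x, hx⟩).mono subset_rfl inter_subset_left)

/-- The term describes `A` around `x` exactly. -/
def RealAt (t : Tm) (A : Set ℝ) (x : ℝ) : Prop := LowAt t A x ∧ HighAt t A x

/-- The term describes `A` exactly. -/
def Realizes (t : Tm) (A : Set ℝ) : Prop := ∃ x, RealAt t A x

theorem emb_of_real {t t' : Tm} (h : t.le t') {A B : Set ℝ} (hA : Realizes t A)
    (hB : Realizes t' B) : Emb A B :=
  let ⟨x, hx⟩ := hA
  let ⟨_, hy⟩ := hB
  emb_of_le h ⟨x, hx.1⟩ hy.2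

/-! ### Decomposition of countable closed sets -/

theorem exists_tail_recurrent (l : ℕ → List Tm) :
    ∃ N, ∀ i ≥ N, ∀ t ∈ l i, ∀ M, ∃ i' ≥ M, ∃ t' ∈ l i', Tm.le t t' := by
  by_contra! hcon
  choose i hi t ht M hM using hcon
  let N : ℕ → ℕ := fun k => Nat.rec 0 (fun _ n => max n (M n)) k
  have hN1 : ∀ k, N (k + 1) = max (N k) (M (N k)) := fun k => rfl
  have hmono : Monotone N := monotone_nat_of_le_succ fun k => by
    rw [hN1]; exact le_max_left _ _
  obtain ⟨j, k, hjk, hle⟩ := Tm.exists_lt_le fun k => t (N k)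
  refine hM (N j) (i (N k)) ?_ _ (ht (N k)) hle
  calc M (N j) ≤ N (j + 1) := by rw [hN1]; exact le_max_right _ _
    _ ≤ N k := hmono hjk
    _ ≤ i (N k) := hi _

theorem half_decomp {Q : Tm → Set ℝ → Prop} {K : Set ℝ} {x δ : ℝ} (hδ : 0 < δ)
    (hK : K.Countable) (hQ : ∀ a b, a < b → a ∉ K → b ∉ K → x - δ < a → b < x →
      ∃ l, SumOf Q l (K ∩ Ioo a b)) :
    (∃ a, x - δ < a ∧ a < x ∧ a ∉ K ∧ K ∩ Ioo a x = ∅) ∨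
    ((∀ y < x, (K ∩ Ioo y x).Nonempty) ∧
    ∃ (s : ℕ → Tm) (c : ℕ → ℝ), x - δ < c 0 ∧ StrictMono c ∧
      Filter.Tendsto c Filter.atTop (nhds x) ∧ (∀ i, c i ∉ K) ∧
      (∀ i, ∃ l, SumOf (fun j => Q (s j)) l (K ∩ Ioo (c i) (c (i + 1)))) ∧
      ∀ j, ∀ y < x, ∃ y' < x, y < y' ∧ ∃ B ⊆ K ∩ Ioo y y', ∃ t', Tm.le (s j) t' ∧ Q t' B) := by
  by_cases hex : ∃ a, x - δ < a ∧ a < x ∧ a ∉ K ∧ K ∩ Ioo a x = ∅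
  · exact Or.inl hex
  refine Or.inr ?_
  have hne : ∀ y < x, (K ∩ Ioo y x).Nonempty := by
    intro y hy
    obtain ⟨a, ha, ha1, ha2⟩ := (hK.dense_compl ℝ).exists_between
      (show max y (x - δ) < x from max_lt hy (by linarith))
    by_contra hcon
    refine hex ⟨a, (le_max_right _ _).trans_lt ha1, ha2, ha, ?_⟩
    rw [not_nonempty_iff_eq_empty] at hcon
    rw [← subset_empty_iff, ← hcon]
    exact inter_subset_inter_right _ (Ioo_subset_Ioo_left ((le_max_left _ _).trans ha1.le))
  refine ⟨hne, ?_⟩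
  obtain ⟨c, hc, hcI, hcx⟩ := Dense.exists_seq_strictMono_tendsto_of_lt
    (hK.dense_compl ℝ) (show x - δ < x by linarith)
  have hl : ∀ i, ∃ l, SumOf Q l (K ∩ Ioo (c i) (c (i + 1))) := fun i =>
    hQ _ _ (hc i.lt_succ_self) (hcI _).2 (hcI _).2 (hcI i).1.1 (hcI (i + 1)).1.2
  choose l hl using hl
  obtain ⟨N, hN⟩ := exists_tail_recurrent l
  have hS : {t | ∃ i ≥ N, t ∈ l i}.Countable := by
    refine (countable_iUnion fun i => (l i).finite_toSet.countable).mono ?_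
    rintro t ⟨i, -, hi⟩
    exact mem_iUnion.2 ⟨i, hi⟩
  have hSne : {t | ∃ i ≥ N, t ∈ l i}.Nonempty := by
    obtain ⟨z, hzK, hz⟩ := hne (c N) (hcI N).1.2
    obtain ⟨n, hn⟩ := exists_mem_Ioo_of_tendsto (c := fun i => c (i + N))
      ((Filter.tendsto_add_atTop_iff_nat N).2 hcx) (by simpa using hz.1) hz.2
      fun i h => (hcI _).2 (h ▸ hzK)
    have h1 := hl (n + N)
    rcases hln : l (n + N) with _ | ⟨t, l'⟩
    · rw [hln] at h1
      have h1 : K ∩ Ioo (c (n + N)) (c (n + N + 1)) = ∅ := h1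
      refine absurd (show z ∈ K ∩ Ioo (c (n + N)) (c (n + N + 1)) from ⟨hzK, ?_⟩)
        (h1 ▸ notMem_empty _)
      rwa [add_right_comm]
    · exact ⟨t, n + N, Nat.le_add_left _ _, by simp [hln]⟩
  obtain ⟨s, hs⟩ := hS.exists_eq_range hSne
  refine ⟨s, fun i => c (i + N), (hcI _).1.1, fun i j hij => hc (Nat.add_lt_add_right hij N),
    (Filter.tendsto_add_atTop_iff_nat N).2 hcx, fun i => (hcI _).2, fun i => ?_, fun j y hy => ?_⟩
  · have h1 := hl (i + N)
    rw [show i + N + 1 = i + 1 + N by ring] at h1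
    refine h1.map fun t ht => ?_
    have h2 : t ∈ range s := hs ▸ ⟨i + N, Nat.le_add_left _ _, ht⟩
    obtain ⟨j, rfl⟩ := h2
    exact ⟨j, fun B hB => hB⟩
  · have h2 : s j ∈ {t | ∃ i ≥ N, t ∈ l i} := hs ▸ mem_range_self j
    obtain ⟨i, hi, hij⟩ := h2
    obtain ⟨M, hM⟩ := (hcx.eventually_const_lt hy).exists
    obtain ⟨i', hi', t', ht', hle⟩ := hN i hi _ hij M
    obtain ⟨B, hB, hQB⟩ := (hl i').exists_piece ht'
    have h3 : y < c i' := hM.trans_le (hc.monotone hi')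
    exact ⟨c (i' + 1), (hcI _).1.2, h3.trans (hc i'.lt_succ_self), B,
      hB.trans (inter_subset_inter_right _ (Ioo_subset_Ioo_left h3.le)), t', hle, hQB⟩

/-- `K` is a finite sum of realizations of terms. -/
def Dec (K : Set ℝ) : Prop := ∃ l, SumOf Realizes l K

theorem Dec.append {K : Set ℝ} {b : ℝ} (hb : b ∉ K) (h₁ : Dec (K ∩ Iio b))
    (h₂ : Dec (K ∩ Ioi b)) : Dec K :=
  let ⟨_, h₁⟩ := h₁
  let ⟨_, h₂⟩ := h₂
  ⟨_, h₁.append hb h₂⟩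

theorem Dec.append_Ioo {K : Set ℝ} {a b c : ℝ} (hb : b ∉ K) (hab : a < b) (hbc : b < c)
    (h₁ : Dec (K ∩ Ioo a b)) (h₂ : Dec (K ∩ Ioo b c)) : Dec (K ∩ Ioo a c) := by
  refine Dec.append (b := b) (fun h => hb h.1) ?_ ?_
  · rwa [inter_assoc, Ioo_inter_Iio, min_eq_right hbc.le]
  · rwa [inter_assoc, Ioo_inter_Ioi, max_eq_right hab.le]

theorem exists_realAt {K : Set ℝ} {x δ : ℝ} (hδ : 0 < δ) (hK : K.Countable) (hx : x ∈ K)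
    (hD : ∀ a b, a < b → a ∉ K → b ∉ K → x - δ < a → b < x + δ → (b < x ∨ x < a) →
      Dec (K ∩ Ioo a b)) :
    ∃ a b t, x - δ < a ∧ a < x ∧ x < b ∧ b < x + δ ∧ a ∉ K ∧ b ∉ K ∧ RealAt t (K ∩ Ioo a b) x ∧
      (t = Tm.pt ∨ ∃ lab s, t = Tm.node lab s ∧ (∃ d, lab d = true)) ∧
      ∀ d, t.lab d = true → ∀ y < sg d x, (rfx d K ∩ Ioo y (sg d x)).Nonempty := by
  have hcnt : ∀ d, (rfx d K).Countable := fun d =>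
    hK.preimage_of_injOn fun y _ z _ h => by simpa [sg_sg] using congrArg (sg d) h
  have hside := fun d => half_decomp (Q := fun t B => Realizes t (rfx d B)) (K := rfx d K)
    (x := sg d x) hδ (hcnt d) (by
      intro a b hab ha hb hxa hbx
      cases d
      · have hx' : sg false x = -x := by simp [sg]
        rw [hx'] at hxa hbx
        obtain ⟨l, hl⟩ := hD (-b) (-a) (neg_lt_neg hab) (by simpa [mem_rfx, sg] using hb)
          (by simpa [mem_rfx, sg] using ha) (by linarith) (by linarith) (Or.inr (by linarith))
        have := hl.rfx_false (m := -b) fun z hz => hz.2.1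
        rw [rfx_inter, rfx_false_Ioo, neg_neg, neg_neg] at this
        exact ⟨_, this⟩
      · have hx' : sg true x = x := by simp [sg]
        rw [hx'] at hxa hbx
        rw [rfx_true] at ha hb
        obtain ⟨l, hl⟩ := hD a b hab ha hb hxa (by linarith) (Or.inl hbx)
        exact ⟨l, by simpa only [rfx_true] using hl⟩)
  have hdata : ∀ d, ∃ (p : ℝ) (f : Bool) (s : ℕ → Tm), sg d x - δ < p ∧ p < sg d x ∧
      p ∉ rfx d K ∧ (f = true → ∀ y < sg d x, (rfx d K ∩ Ioo y (sg d x)).Nonempty) ∧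
      ∀ A : Set ℝ, A ⊆ K → rfx d A ∩ Iio (sg d x) = rfx d K ∩ Ioo p (sg d x) →
        (if f = true then LowHalf (fun j B => ∃ y, LowAt (s j) (rfx d B) y) (rfx d A) (sg d x)
          else rfx d A ∩ Iio (sg d x) = ∅) ∧ (f = true → HighHalf d s A x) := by
    intro d
    rcases hside d with ⟨p, hp1, hp2, hp3, hp4⟩ | ⟨hne, s, c, hc0, hc, hcx, hcK, hcl, hch⟩
    · exact ⟨p, false, fun _ => Tm.pt, hp1, hp2, hp3, by simp, fun A _ hA => by simp [hA, hp4]⟩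
    · have hclt : ∀ i, c i < sg d x := fun i =>
        (hc i.lt_succ_self).trans_le (hc.monotone.ge_of_tendsto hcx (i + 1))
      refine ⟨c 0, true, s, hc0, hclt 0, hcK 0, fun _ => hne, fun A hAK hA => ?_⟩
      simp only [if_true, forall_true_left]
      have hAB : ∀ y z, c 0 ≤ y → z ≤ sg d x → rfx d K ∩ Ioo y z = rfx d A ∩ Ioo y z := by
        intro y z hy hz
        refine Subset.antisymm ?_ (inter_subset_inter_left _ (rfx_mono d hAK))
        rintro w ⟨hw, hw1, hw2⟩
        have : w ∈ rfx d A ∩ Iio (sg d x) := by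
          rw [hA]; exact ⟨hw, hy.trans_lt hw1, hw2.trans_le hz⟩
        exact ⟨this.1, hw1, hw2⟩
      refine ⟨⟨c, hc, hcx, fun i h => hcK i (rfx_mono d hAK h), ?_, fun i => ?_⟩, ?_⟩
      · rw [hA]; exact fun z hz => hz.2.1
      · obtain ⟨l, hl⟩ := hcl i
        rw [hAB _ _ (hc.monotone (Nat.zero_le i)) (hclt _).le] at hl
        exact hl.map fun j _ => ⟨j, fun B ⟨y, hy⟩ => ⟨y, hy.1⟩⟩
      · intro j y hy
        obtain ⟨y', h1, h2, B, hB, t', hle, z, hz⟩ := hch j (max y (c 0)) (max_lt hy (hclt 0))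
        refine ⟨y', h1, (le_max_left _ _).trans_lt h2, fun u C hu hC => ?_⟩
        rw [hAB _ _ (le_max_right _ _) h1.le] at hB
        refine ((emb_of_le (hu.trans hle) hC hz.2).rfx d).mono subset_rfl ?_
        rw [rfx_rfx]
        exact hB.trans (inter_subset_inter_right _ (Ioo_subset_Ioo_left (le_max_left _ _)))
  choose p f s hp1 hp2 hp3 hne hA using hdata
  have hx0 : sg false x = -x := by simp [sg]
  have hx1 : sg true x = x := by simp [sg]
  have h1 := hp1 true
  have h2 := hp2 true
  have h3 := hp1 false
  have h4 := hp2 false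
  rw [hx0] at h3 h4
  rw [hx1] at h1 h2
  set A := K ∩ Ioo (p true) (-p false) with hAdef
  have hxA : x ∈ A := ⟨hx, h2, by linarith⟩
  have hA' := fun d => hA d A inter_subset_left (by
    cases d
    · rw [hAdef, rfx_inter, rfx_false_Ioo, neg_neg, hx0, inter_assoc, Ioo_inter_Iio,
        min_eq_right (by linarith)]
    · rw [hAdef, rfx_true, rfx_true, hx1, inter_assoc, Ioo_inter_Iio,
        min_eq_right (by linarith)])
  refine ⟨p true, -p false, if ∃ d, f d = true then Tm.node f s else Tm.pt, h1, h2, by linarith,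
    by linarith, by simpa using hp3 true, by simpa [mem_rfx, sg] using hp3 false, ?_, ?_, ?_⟩
  · split_ifs with hf
    · exact ⟨⟨hxA, fun d => (hA' d).1⟩, hxA, fun d hd => (hA' d).2 hd⟩
    · refine ⟨?_, hxA, fun d hd => by simp [Tm.lab] at hd⟩
      have h5 : ∀ d, rfx d A ∩ Iio (sg d x) = ∅ := fun d => by
        have := (hA' d).1
        rwa [if_neg fun h => hf ⟨d, h⟩] at this
      have h6 := h5 true
      have h7 := h5 false
      rw [rfx_true, hx1] at h6
      rw [hx0] at h7
      change A = {x}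
      refine Subset.antisymm (fun z hz => ?_) (by simpa using hxA)
      rcases lt_trichotomy z x with h | h | h
      · exact absurd (show z ∈ A ∩ Iio x from ⟨hz, h⟩) (h6 ▸ notMem_empty _)
      · exact h
      · exact absurd (show -z ∈ rfx false A ∩ Iio (-x) from
          ⟨by simpa [mem_rfx, sg] using hz, neg_lt_neg h⟩) (h7 ▸ notMem_empty _)
  · split_ifs with hf
    · exact Or.inr ⟨f, s, rfl, hf⟩
    · exact Or.inl rfl
  · split_ifs with hf
    · exact fun d hd => hne d hd
    · exact fun d hd => by simp [Tm.lab] at hd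

theorem exists_isolated_of_countable {B : Set ℝ} (hB : IsClosed B) (hc : B.Countable)
    (hne : B.Nonempty) : ∃ x ∈ B, ∃ δ > 0, ∀ y ∈ B, x - δ < y → y < x + δ → y = x := by
  by_contra! hcon
  have hp : Perfect B := by
    refine ⟨hB, preperfect_iff_nhds.2 fun x hx U hU => ?_⟩
    obtain ⟨δ, hδ, hU⟩ := Metric.mem_nhds_iff.1 hU
    obtain ⟨y, hy, h1, h2, h3⟩ := hcon x hx δ hδ
    refine ⟨y, ⟨hU ?_, hy⟩, h3⟩
    rw [Real.ball_eq_Ioo]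
    exact ⟨h1, h2⟩
  obtain ⟨f, hf, -, hinj⟩ := hp.exists_nat_bool_injection hne
  have : Countable (ℕ → Bool) := by
    have := hc.to_subtype
    exact Function.Injective.countable (f := fun u => (⟨f u, hf (mem_range_self u)⟩ : B))
      fun u v h => hinj (congrArg Subtype.val h)
  obtain ⟨e, he⟩ := exists_surjective_nat (ℕ → Bool)
  obtain ⟨n, hn⟩ := he fun n => !(e n n)
  have := congrFun hn n
  simp at this

/-- All small enough intervals around `x` with endpoints outside `K` decompose. -/
def Good (K : Set ℝ) (x : ℝ) : Prop :=
  ∃ δ > 0, ∀ a b, a < b → a ∉ K → b ∉ K → x - δ < a → b < x + δ → Dec (K ∩ Ioo a b)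

theorem dec_Ioo_of_good {K : Set ℝ} (hK : K.Countable) {p q : ℝ}
    (hg : ∀ x ∈ Icc p q, Good K x) {a b : ℝ} (hpa : p ≤ a) (hbq : b ≤ q) (hab : a < b)
    (ha : a ∉ K) (hb : b ∉ K) : Dec (K ∩ Ioo a b) := by
  choose! δ hδ hD using hg
  obtain ⟨ε, hε, hball⟩ := lebesgue_number_lemma_of_metric
    (c := fun x : Icc p q => Metric.ball x.1 (δ x.1)) (isCompact_Icc (a := p) (b := q))
    (fun _ => Metric.isOpen_ball)
    fun x hx => mem_iUnion.2 ⟨⟨x, hx⟩, Metric.mem_ball_self (hδ x hx)⟩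
  have hsmall : ∀ a b, p ≤ a → b ≤ q → a < b → a ∉ K → b ∉ K → b - a < ε →
      Dec (K ∩ Ioo a b) := by
    intro a b hpa hbq hab ha hb hε'
    obtain ⟨⟨x, hx⟩, hsub⟩ := hball a ⟨hpa, hab.le.trans hbq⟩
    have h1 := hsub (Metric.mem_ball_self hε)
    have h2 : b ∈ Metric.ball a ε := by rw [Real.ball_eq_Ioo]; constructor <;> linarith
    have h2 := hsub h2
    rw [Real.ball_eq_Ioo] at h1 h2
    exact hD x hx a b hab ha hb h1.1 h2.2
  have hind : ∀ n : ℕ, ∀ b, b ≤ q → a < b → b ∉ K → b - a < n * (ε / 2) →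
      Dec (K ∩ Ioo a b) := by
    intro n
    induction n with
    | zero => intro b _ h1 _ h2; simp at h2; linarith
    | succ n ih =>
      intro b hbq hab hb hn
      by_cases hε' : b - a < ε
      · exact hsmall a b hpa hbq hab ha hb hε'
      · obtain ⟨c, hc, hc1, hc2⟩ := (hK.dense_compl ℝ).exists_between
          (show b - ε < b - ε / 2 by linarith)
        push_cast at hn
        refine Dec.append_Ioo (b := c) hc (by linarith) (by linarith)
          (ih c (by linarith) (by linarith) hc (by linarith))
          (hsmall c b (by linarith) hbq (by linarith) hc hb (by linarith))
  obtain ⟨n, hn⟩ := exists_nat_gt ((b - a) / (ε / 2))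
  exact hind n b hbq hab hb ((div_lt_iff₀ (by linarith)).1 hn)

theorem good_of_notMem {K : Set ℝ} (hK : IsClosed K) {x : ℝ} (hx : x ∉ K) : Good K x := by
  obtain ⟨δ, hδ, hsub⟩ := Metric.mem_nhds_iff.1 (hK.isOpen_compl.mem_nhds hx)
  refine ⟨δ, hδ, fun a b _ _ _ h1 h2 => ⟨[], ?_⟩⟩
  refine eq_empty_of_forall_notMem fun z hz => hsub ?_ hz.1
  rw [Real.ball_eq_Ioo]
  exact ⟨h1.trans hz.2.1, hz.2.2.trans h2⟩

theorem isOpen_good (K : Set ℝ) : IsOpen {x | Good K x} := by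
  refine Metric.isOpen_iff.2 fun x ⟨δ, hδ, h⟩ => ⟨δ / 2, by linarith, fun y hy => ?_⟩
  rw [Real.ball_eq_Ioo] at hy
  refine ⟨δ / 2, by linarith, fun a b hab ha hb h1 h2 => h a b hab ha hb ?_ ?_⟩
  · linarith [hy.1]
  · linarith [hy.2]

theorem good_of_punctured {K : Set ℝ} (hK : K.Countable) {x δ : ℝ} (hx : x ∈ K) (hδ : 0 < δ)
    (hD : ∀ a b, a < b → a ∉ K → b ∉ K → x - δ < a → b < x + δ → (b < x ∨ x < a) →
      Dec (K ∩ Ioo a b)) : Good K x := by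
  refine ⟨δ, hδ, fun a b hab ha hb h1 h2 => ?_⟩
  by_cases hside : b < x ∨ x < a
  · exact hD a b hab ha hb h1 h2 hside
  push Not at hside
  have hax : a < x := lt_of_le_of_ne hside.2 fun h => ha (h ▸ hx)
  have hbx : x < b := lt_of_le_of_ne hside.1 fun h => hb (h ▸ hx)
  have hpos : 0 < min (x - a) (b - x) := lt_min (by linarith) (by linarith)
  obtain ⟨a', b', t, h3, h4, h5, h6, h7, h8, h9, -⟩ := exists_realAt hpos hK hx
    fun c d hcd hc hd h3 h4 h5 => hD c d hcd hc hd
      (by linarith [min_le_left (x - a) (b - x)]) (by linarith [min_le_right (x - a) (b - x)]) h5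
  have h10 := min_le_left (x - a) (b - x)
  have h11 := min_le_right (x - a) (b - x)
  refine Dec.append_Ioo h7 (by linarith) (by linarith)
    (hD a a' (by linarith) ha h7 h1 (by linarith) (Or.inl h4)) ?_
  refine Dec.append_Ioo h8 (by linarith) (by linarith) ⟨[t], ?_⟩
    (hD b' b (by linarith) h8 hb (by linarith) h2 (Or.inr h5))
  exact SumOf.singleton (M := b') ⟨x, h9⟩ fun z hz => hz.2.2

theorem good_of_countable {K : Set ℝ} (hK : IsClosed K) (hc : K.Countable) (x : ℝ) :
    Good K x := by
  by_contra hx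
  have hsub : {x | Good K x}ᶜ ⊆ K := fun y hy => by
    by_contra h
    exact hy (good_of_notMem hK h)
  obtain ⟨x, hxB, δ, hδ, hiso⟩ := exists_isolated_of_countable
    (isOpen_good K).isClosed_compl (hc.mono hsub) ⟨x, hx⟩
  refine hxB (good_of_punctured hc (hsub hxB) hδ fun a b hab ha hb h1 h2 h3 => ?_)
  refine dec_Ioo_of_good hc (p := a) (q := b) (fun y hy => ?_) le_rfl le_rfl hab ha hb
  by_contra hy'
  have := hiso y hy' (by linarith [hy.1]) (by linarith [hy.2])
  rcases h3 with h3 | h3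
  · linarith [hy.2]
  · linarith [hy.1]

theorem dec_Ioo {K : Set ℝ} (hK : IsClosed K) (hc : K.Countable) {a b : ℝ} (hab : a < b)
    (ha : a ∉ K) (hb : b ∉ K) : Dec (K ∩ Ioo a b) :=
  dec_Ioo_of_good hc (fun x _ => good_of_countable hK hc x) le_rfl le_rfl hab ha hb

theorem exists_germ {K : Set ℝ} (hK : IsClosed K) (hc : K.Countable) {x δ : ℝ} (hx : x ∈ K)
    (hδ : 0 < δ) :
    ∃ a b t, x - δ < a ∧ a < x ∧ x < b ∧ b < x + δ ∧ a ∉ K ∧ b ∉ K ∧ RealAt t (K ∩ Ioo a b) x ∧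
      (t = Tm.pt ∨ ∃ lab s, t = Tm.node lab s ∧ (∃ d, lab d = true)) ∧
      ∀ d, t.lab d = true → ∀ y < sg d x, (rfx d K ∩ Ioo y (sg d x)).Nonempty :=
  exists_realAt hδ hc hx fun _ _ hab ha hb _ _ _ => dec_Ioo hK hc hab ha hb

/-! ### Embedding countable sets into uncountable closed sets -/

theorem countable_of_initial {S : Set ℝ} (h : ∀ x ∈ S, (S ∩ Iio x).Countable) : S.Countable := by
  by_cases hmax : ∃ m ∈ S, ∀ x ∈ S, x ≤ m
  · obtain ⟨m, hm, hle⟩ := hmax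
    refine ((h m hm).insert m).mono fun x hx => ?_
    rcases (hle x hx).eq_or_lt with h1 | h1
    · exact Or.inl h1
    · exact Or.inr ⟨hx, h1⟩
  · push Not at hmax
    refine (countable_iUnion fun q : {q : ℚ // (S ∩ Iio (q : ℝ)).Countable} => q.2).mono
      fun x hx => ?_
    obtain ⟨y, hy, hxy⟩ := hmax x hx
    obtain ⟨q, h1, h2⟩ := exists_rat_btwn hxy
    exact mem_iUnion.2 ⟨⟨q, (h y hy).mono (inter_subset_inter_right _ (Iio_subset_Iio h2.le))⟩,
      hx, h1⟩

theorem countable_left_thin (L : Set ℝ) :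
    {x ∈ L | ∃ a < x, (L ∩ Ioo a x).Countable}.Countable := by
  have key : ∀ q : ℚ, {x ∈ L | (q : ℝ) < x ∧ (L ∩ Ioo (q : ℝ) x).Countable}.Countable :=
    fun q => countable_of_initial fun x hx => hx.2.2.mono (by
      rintro z ⟨⟨h1, h2, -⟩, h3⟩
      exact ⟨h1, h2, h3⟩)
  refine (countable_iUnion key).mono ?_
  rintro x ⟨hx, a, hax, hc⟩
  obtain ⟨q, h1, h2⟩ := exists_rat_btwn hax
  exact mem_iUnion.2 ⟨q, hx, h2, hc.mono (inter_subset_inter_right _ (Ioo_subset_Ioo_left h1.le))⟩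

theorem Countable.rfx {K : Set ℝ} (h : K.Countable) (d : Bool) : (rfx d K).Countable :=
  h.preimage_of_injOn fun y _ z _ h => by simpa [sg_sg] using congrArg (sg d) h

theorem countable_right_thin (L : Set ℝ) :
    {x ∈ L | ∃ b > x, (L ∩ Ioo x b).Countable}.Countable := by
  refine (Countable.rfx (countable_left_thin (rfx false L)) false).mono ?_
  rintro x ⟨hx, b, hb, hc⟩
  refine ⟨by rwa [mem_rfx, sg_sg], -b, by simpa [sg] using hb, ?_⟩
  have := Countable.rfx hc false
  rw [rfx_inter, rfx_false_Ioo] at this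
  simpa [sg] using this

theorem exists_rat_strictMono {L : Set ℝ} (hL : ¬ L.Countable) :
    ∃ e : ℚ → ℝ, StrictMono e ∧ ∀ q, e q ∈ L := by
  let T : Set ℝ := {x ∈ L | ∃ a < x, (L ∩ Ioo a x).Countable} ∪
    {x ∈ L | ∃ b > x, (L ∩ Ioo x b).Countable}
  have hT : T.Countable := (countable_left_thin L).union (countable_right_thin L)
  have hnc : ∀ S : Set ℝ, ¬ S.Countable → (S \ T).Infinite := fun S hS hfin =>
    hS ((hfin.countable.union hT).mono fun x hx => by
      by_cases h : x ∈ T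
      · exact Or.inr h
      · exact Or.inl ⟨hx, h⟩)
  have hinf := hnc L hL
  have : Nontrivial (L \ T : Set ℝ) := hinf.nontrivial.coe_sort
  have : DenselyOrdered (L \ T : Set ℝ) := by
    refine ⟨fun x y hxy => ?_⟩
    have h1 : ¬ (L ∩ Ioo x.1 y.1).Countable := fun h =>
      x.2.2 (Or.inr ⟨x.2.1, y.1, hxy, h⟩)
    obtain ⟨z, hz, hzT⟩ := (hnc _ h1).nonempty
    exact ⟨⟨z, hz.1, hzT⟩, hz.2.1, hz.2.2⟩
  obtain ⟨e⟩ := Order.embedding_from_countable_to_dense ℚ (L \ T : Set ℝ)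
  exact ⟨fun q => (e q).1, fun p q h => e.strictMono h, fun q => (e q).2.1⟩

theorem emb_of_uncountable {D L : Set ℝ} (hD : D.Countable) (hL : IsClosed L)
    (hLc : ¬ L.Countable) : Emb D L := by
  obtain ⟨e, he, heL⟩ := exists_rat_strictMono hLc
  let S : ℝ → Set ℝ := fun y => e '' {r : ℚ | (r : ℝ) < y}
  have hne : ∀ y, (S y).Nonempty := fun y =>
    let ⟨r, hr⟩ := exists_rat_lt y
    ⟨e r, r, hr, rfl⟩
  have hub : ∀ (y : ℝ) (r : ℚ), y ≤ r → e r ∈ upperBounds (S y) := by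
    rintro y r hr _ ⟨q, hq, rfl⟩
    exact he.monotone (Rat.cast_le.1 ((le_of_lt hq).trans hr))
  have hbdd : ∀ y, BddAbove (S y) := fun y =>
    let ⟨r, hr⟩ := exists_rat_gt y
    ⟨e r, hub y r hr.le⟩
  have hf : StrictMono fun y => sSup (S y) := by
    intro y z hyz
    obtain ⟨r, h1, h2⟩ := exists_rat_btwn hyz
    obtain ⟨q, h3, h4⟩ := exists_rat_btwn h2
    exact (csSup_le (hne y) (hub y r h1.le)).trans_lt
      ((he (Rat.cast_lt.1 h3)).trans_le (le_csSup (hbdd z) ⟨q, h4, rfl⟩))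
  have hfL : ∀ y, sSup (S y) ∈ L := fun y =>
    closure_minimal (by rintro _ ⟨q, -, rfl⟩; exact heL q) hL
      (csSup_mem_closure (hne y) (hbdd y))
  have hC := hf.monotone.countable_not_continuousAt
  have hbad : (image2 (fun c x : ℝ => c - x)
      {x | ¬ ContinuousAt (fun y => sSup (S y)) x} D).Countable := hC.image2 hD _
  obtain ⟨τ, hτ⟩ := (hbad.dense_compl ℝ).nonempty
  refine ⟨fun x => sSup (S (x + τ)), fun x _ => hfL _, fun x _ y _ hxy =>
    hf (add_lt_add_left hxy τ), fun x hx => ?_⟩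
  have hx' : ContinuousAt (fun y => sSup (S y)) (x + τ) := by
    by_contra h
    exact hτ ⟨x + τ, h, x, hx, by ring⟩
  exact (ContinuousAt.comp (f := fun x => x + τ) hx' (by fun_prop)).continuousWithinAt

/-! ### Transfer between Gödel logics -/

section Countable

variable {ar : ℕ → ℕ}

/-- Formulas of bounded depth. -/
def stage (ar : ℕ → ℕ) : ℕ → Set (GFormula ar)
  | 0 => ∅
  | n + 1 => stage ar n ∪ ({GFormula.bot} ∪ range (fun q : Σ p, (Fin (ar p) → ℕ) =>
      GFormula.atom q.1 q.2) ∪ image2 GFormula.conj (stage ar n) (stage ar n) ∪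
      image2 GFormula.disj (stage ar n) (stage ar n) ∪
      image2 GFormula.imp (stage ar n) (stage ar n) ∪
      GFormula.all '' stage ar n ∪ GFormula.ex '' stage ar n)

theorem countable_stage (n : ℕ) : (stage ar n).Countable := by
  induction n with
  | zero => exact countable_empty
  | succ n ih =>
    exact ih.union ((((((countable_singleton _).union (countable_range _)).union
      (ih.image2 ih _)).union (ih.image2 ih _)).union (ih.image2 ih _)).union
      (ih.image _) |>.union (ih.image _))

theorem monotone_stage : Monotone (stage ar) :=
  monotone_nat_of_le_succ fun _ => subset_union_left

theorem exists_mem_stage (φ : GFormula ar) : ∃ n, φ ∈ stage ar n := by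
  have key : ∀ φ ψ : GFormula ar, (∃ n, φ ∈ stage ar n) → (∃ n, ψ ∈ stage ar n) →
      ∃ n, φ ∈ stage ar n ∧ ψ ∈ stage ar n := by
    rintro φ ψ ⟨m, hm⟩ ⟨n, hn⟩
    exact ⟨max m n, monotone_stage (le_max_left _ _) hm, monotone_stage (le_max_right _ _) hn⟩
  induction φ with
  | bot => exact ⟨1, by simp [stage]⟩
  | atom p ts => exact ⟨1, by simp [stage]⟩
  | conj φ ψ h1 h2 =>
    obtain ⟨n, h1, h2⟩ := key φ ψ h1 h2
    exact ⟨n + 1, by simp [stage, h1, h2]⟩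
  | disj φ ψ h1 h2 =>
    obtain ⟨n, h1, h2⟩ := key φ ψ h1 h2
    exact ⟨n + 1, by simp [stage, h1, h2]⟩
  | imp φ ψ h1 h2 =>
    obtain ⟨n, h1, h2⟩ := key φ ψ h1 h2
    exact ⟨n + 1, by simp [stage, h1, h2]⟩
  | all φ h =>
    obtain ⟨n, h⟩ := h
    exact ⟨n + 1, by simp [stage, h]⟩
  | ex φ h =>
    obtain ⟨n, h⟩ := h
    exact ⟨n + 1, by simp [stage, h]⟩

theorem countable_formula (ar : ℕ → ℕ) : Countable (GFormula ar) := by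
  rw [← countable_univ_iff]
  exact (countable_iUnion countable_stage).mono fun φ _ => mem_iUnion.2 (exists_mem_stage φ)

end Countable

section Eval

variable {ar : ℕ → ℕ} {V : Set ℝ}

theorem geval_congr (v : GValuation ar V) {φ : GFormula ar} {k : ℕ} (hφ : φ.VarsBelow k)
    {e e' : ℕ → v.M} (h : ∀ i < k, e i = e' i) : geval v e φ = geval v e' φ := by
  induction φ generalizing k e e' with
  | bot => rfl
  | atom p ts =>
    simp only [geval]
    congr 1
    funext i
    exact h _ (hφ i)
  | conj φ ψ h1 h2 => simp only [geval, h1 hφ.1 h, h2 hφ.2 h]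
  | disj φ ψ h1 h2 => simp only [geval, h1 hφ.1 h, h2 hφ.2 h]
  | imp φ ψ h1 h2 => simp only [geval, h1 hφ.1 h, h2 hφ.2 h]
  | all φ h1 =>
    have : ∀ m, geval v (consEnv m e) φ = geval v (consEnv m e') φ := fun m => by
      refine h1 (k := k + 1) hφ fun i hi => ?_
      cases i with
      | zero => rfl
      | succ i => exact h i (Nat.lt_of_succ_lt_succ hi)
    simp only [geval, this]
  | ex φ h1 =>
    have : ∀ m, geval v (consEnv m e) φ = geval v (consEnv m e') φ := fun m => by
      refine h1 (k := k + 1) hφ fun i hi => ?_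
      cases i with
      | zero => rfl
      | succ i => exact h i (Nat.lt_of_succ_lt_succ hi)
    simp only [geval, this]

theorem geval_mem (hV : GodelSet V) (v : GValuation ar V) (e : ℕ → v.M) (φ : GFormula ar) :
    geval v e φ ∈ V := by
  induction φ generalizing e with
  | bot => exact hV.2.2.1
  | atom p ts => exact v.interp_mem _ _
  | conj φ ψ h1 h2 =>
    simp only [geval]
    rcases min_choice (geval v e φ) (geval v e ψ) with h | h <;> rw [h]
    · exact h1 e
    · exact h2 e
  | disj φ ψ h1 h2 =>
    simp only [geval]
    rcases max_choice (geval v e φ) (geval v e ψ) with h | h <;> rw [h]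
    · exact h1 e
    · exact h2 e
  | imp φ ψ h1 h2 =>
    simp only [geval]
    split_ifs
    · exact hV.2.2.2
    · exact h2 e
  | all φ h1 =>
    have := v.ne
    refine closure_minimal ?_ hV.1 (csInf_mem_closure (range_nonempty _)
      ⟨0, ?_⟩)
    · rintro _ ⟨m, rfl⟩; exact h1 _
    · rintro _ ⟨m, rfl⟩; exact (hV.2.1 (h1 _)).1
  | ex φ h1 =>
    have := v.ne
    refine closure_minimal ?_ hV.1 (csSup_mem_closure (range_nonempty _)
      ⟨1, ?_⟩)
    · rintro _ ⟨m, rfl⟩; exact h1 _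
    · rintro _ ⟨m, rfl⟩; exact (hV.2.1 (h1 _)).2

theorem gnorm_eq_one_iff (hV : GodelSet V) (φ : GFormula ar) :
    GNorm ar V φ = 1 ↔ ∀ v : GValuation ar V, v.val φ = 1 := by
  have hle : ∀ v : GValuation ar V, v.val φ ∈ Icc (0 : ℝ) 1 := fun v =>
    hV.2.1 (geval_mem hV v _ φ)
  have : Nonempty (GValuation ar V) := ⟨⟨Unit, ⟨()⟩, fun _ _ => 0, fun _ _ => hV.2.2.1⟩⟩
  constructor
  · intro h v
    refine le_antisymm (hle v).2 (h ▸ csInf_le ⟨0, ?_⟩ (mem_range_self v))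
    rintro _ ⟨w, rfl⟩; exact (hle w).1
  · intro h
    simp only [GNorm, h, range_const, csInf_singleton]

end Eval

/-- Countable parts of `V` can be mapped to `W` by truth preserving maps. -/
def LeG (V W : Set ℝ) : Prop :=
  ∀ D ⊆ V, D.Countable → (0 : ℝ) ∈ D → (1 : ℝ) ∈ D → ∀ x₀ ∈ D, x₀ < 1 →
    ∃ h : ℝ → ℝ, ContinuousOn h D ∧ MapsTo h D W ∧ h 0 = 0 ∧ h 1 = 1 ∧ MonotoneOn h D ∧
      (∀ y ∈ D, ∀ z ∈ D, y < z → h y < h z ∨ h y = 1) ∧ h x₀ < 1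

theorem exists_seq_sInf_sSup {M : Type} [Nonempty M] (f : M → ℝ) (hf : ∀ m, f m ∈ Icc (0 : ℝ) 1) :
    ∃ c : ℕ → M, ∀ S : Set M, range c ⊆ S →
      sInf (f '' S) = sInf (range f) ∧ sSup (f '' S) = sSup (range f) := by
  have hb : BddBelow (range f) := ⟨0, by rintro _ ⟨m, rfl⟩; exact (hf m).1⟩
  have ha : BddAbove (range f) := ⟨1, by rintro _ ⟨m, rfl⟩; exact (hf m).2⟩
  obtain ⟨u, -, hu, hu'⟩ := exists_seq_tendsto_sInf (range_nonempty f) hb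
  obtain ⟨w, -, hw, hw'⟩ := exists_seq_tendsto_sSup (range_nonempty f) ha
  choose a haf using hu'
  choose b hbf using hw'
  let p : Set M := range a ∪ range b
  have hp : p.Countable := (countable_range a).union (countable_range b)
  obtain ⟨c, hc⟩ := hp.exists_eq_range ⟨a 0, Or.inl (mem_range_self _)⟩
  refine ⟨c, fun S hS => ?_⟩
  rw [← hc] at hS
  have hsub : f '' S ⊆ range f := image_subset_range f S
  have hne : (f '' S).Nonempty := ⟨f (a 0), a 0, hS (Or.inl (mem_range_self _)), rfl⟩
  refine ⟨le_antisymm (ge_of_tendsto' hu fun n => csInf_le (hb.mono hsub) ?_)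
    (csInf_le_csInf hb hne hsub), le_antisymm (csSup_le_csSup ha hne hsub)
    (le_of_tendsto' hw fun n => le_csSup (ha.mono hsub) ?_)⟩
  · exact ⟨a n, hS (Or.inl (mem_range_self _)), haf n⟩
  · exact ⟨b n, hS (Or.inr (mem_range_self _)), hbf n⟩

theorem exists_countable_closed {M I : Type} [Countable I] (m₀ : M) (F : I → List M → M) :
    ∃ S : Set M, S.Countable ∧ m₀ ∈ S ∧ ∀ i l, (∀ x ∈ l, x ∈ S) → F i l ∈ S := by
  let step : Set M → Set M := fun S =>
    S ∪ range fun q : I × List S => F q.1 (q.2.map fun x => x.1)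
  let st : ℕ → Set M := fun n => Nat.rec {m₀} (fun _ S => step S) n
  have hcnt : ∀ n, (st n).Countable := by
    intro n
    induction n with
    | zero => exact countable_singleton _
    | succ n ih =>
      have := ih.to_subtype
      exact ih.union (countable_range _)
  have hmono : Monotone st := monotone_nat_of_le_succ fun n => subset_union_left
  have hlist : ∀ l : List M, (∀ x ∈ l, x ∈ ⋃ n, st n) →
      ∃ n, ∃ l' : List {x // x ∈ st n}, l'.map (fun x => x.1) = l := by
    intro l hl
    have : ∃ n, ∀ x ∈ l, x ∈ st n := by
      induction l with
      | nil => exact ⟨0, by simp⟩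
      | cons a l ih =>
        obtain ⟨n, hn⟩ := ih fun x hx => hl x (List.mem_cons_of_mem _ hx)
        obtain ⟨m, hm⟩ := mem_iUnion.1 (hl a List.mem_cons_self)
        refine ⟨max m n, fun x hx => ?_⟩
        rcases List.mem_cons.1 hx with rfl | hx
        · exact hmono (le_max_left _ _) hm
        · exact hmono (le_max_right _ _) (hn x hx)
    obtain ⟨n, hn⟩ := this
    exact ⟨n, l.attachWith _ hn, by simp⟩
  refine ⟨⋃ n, st n, countable_iUnion hcnt, mem_iUnion.2 ⟨0, rfl⟩, fun i l hl => ?_⟩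
  obtain ⟨n, l', rfl⟩ := hlist l hl
  exact mem_iUnion.2 ⟨n + 1, Or.inr ⟨(i, l'), rfl⟩⟩

/-- The environment listing `l`, and then constantly `m`. -/
def envOf {M : Type} (m : M) (l : List M) (i : ℕ) : M := (l[i]?).getD m

theorem consEnv_envOf {M : Type} (m a : M) (l : List M) :
    consEnv a (envOf m l) = envOf m (a :: l) := by
  funext i
  cases i <;> simp [consEnv, envOf]

theorem gLogic_subset_of_leG {ar : ℕ → ℕ} {V W : Set ℝ} (hV : GodelSet V) (hW : GodelSet W)
    (hVW : LeG V W) : GLogic ar W ⊆ GLogic ar V := by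
  rintro φ ⟨hφ, hφW⟩
  refine ⟨hφ, (gnorm_eq_one_iff hV φ).2 fun v => ?_⟩
  rw [gnorm_eq_one_iff hW] at hφW
  by_contra hne
  have hlt : v.val φ < 1 := lt_of_le_of_ne (hV.2.1 (geval_mem hV v _ φ)).2 hne
  have := v.ne
  have := countable_formula ar
  let m₀ : v.M := Classical.choice v.ne
  choose c hc using fun (ψ : GFormula ar) (l : List v.M) =>
    exists_seq_sInf_sSup (fun m => geval v (envOf m₀ (m :: l)) ψ)
      fun m => hV.2.1 (geval_mem hV v _ ψ)
  obtain ⟨S, hS, hm₀, hcl⟩ := exists_countable_closed (I := GFormula ar × ℕ) m₀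
    fun q l => c q.1 l q.2
  have := hS.to_subtype
  let ev : List S → GFormula ar → ℝ := fun l ψ => geval v (envOf m₀ (l.map Subtype.val)) ψ
  let D : Set ℝ := range fun q : List S × GFormula ar => ev q.1 q.2
  have hDmem : ∀ l ψ, ev l ψ ∈ D := fun l ψ => ⟨(l, ψ), rfl⟩
  have hval : v.val φ = ev [] φ := geval_congr v hφ fun i hi => absurd hi (Nat.not_lt_zero i)
  have h1D : (1 : ℝ) ∈ D := ⟨([], .imp .bot .bot), by simp [ev, geval]⟩
  obtain ⟨h, hcont, hmaps, h0, h1, hmon, hstr, hx₀⟩ := hVW D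
    (by rintro _ ⟨q, rfl⟩; exact geval_mem hV v _ _) (countable_range _)
    ⟨([], .bot), rfl⟩ h1D (v.val φ) (hval ▸ hDmem _ _) hlt
  let w : GValuation ar W :=
    { M := S
      ne := ⟨⟨m₀, hm₀⟩⟩
      interp := fun p t => h (v.interp p fun i => (t i).1)
      interp_mem := fun p t => hmaps ⟨(List.ofFn t, .atom p fun i => i), by
        simp [ev, geval, envOf]⟩ }
  have henv : ∀ (l : List S) i, (envOf (⟨m₀, hm₀⟩ : S) l i).1 =
      envOf m₀ (l.map Subtype.val) i := by
    intro l i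
    simp only [envOf, List.getElem?_map]
    cases l[i]? <;> rfl
  have hbd : BddBelow D ∧ BddAbove D := by
    refine ⟨⟨0, ?_⟩, ⟨1, ?_⟩⟩ <;> rintro _ ⟨q, rfl⟩
    · exact (hV.2.1 (geval_mem hV v _ _)).1
    · exact (hV.2.1 (geval_mem hV v _ _)).2
  have hquant : ∀ l ψ, (∃ f : S → ℝ, range f ⊆ D ∧ (∀ m, f m = ev (m :: l) ψ) ∧
      sInf (range f) = ev l (.all ψ) ∧ sSup (range f) = ev l (.ex ψ)) := by
    intro l ψ
    refine ⟨fun m => ev (m :: l) ψ, ?_, fun _ => rfl, ?_⟩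
    · rintro _ ⟨m, rfl⟩; exact hDmem _ _
    · have hl : ∀ x ∈ l.map Subtype.val, x ∈ S := by
        intro x hx
        obtain ⟨y, -, rfl⟩ := List.mem_map.1 hx
        exact y.2
      have h2 := hc ψ (l.map Subtype.val) S (by
        rintro _ ⟨n, rfl⟩; exact hcl (ψ, n) _ hl)
      have h3 : (fun m => geval v (envOf m₀ (m :: l.map Subtype.val)) ψ) '' S =
          range fun m : S => ev (m :: l) ψ := by
        rw [image_eq_range]; rfl
      rw [h3] at h2
      simp only [h2, ev, geval, consEnv_envOf, and_self]
  have key : ∀ (ψ : GFormula ar) (l : List S),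
      geval w (envOf (⟨m₀, hm₀⟩ : S) l) ψ = h (ev l ψ) := by
    intro ψ
    induction ψ with
    | bot => intro l; exact h0.symm
    | atom p ts => 
      intro l
      simp only [geval, ev, w, henv]
    | conj φ ψ h2 h3 =>
      intro l
      simp only [geval, h2, h3]
      exact (hmon.map_min (hDmem _ _) (hDmem _ _)).symm
    | disj φ ψ h2 h3 =>
      intro l
      simp only [geval, h2, h3]
      exact (hmon.map_max (hDmem _ _) (hDmem _ _)).symm
    | imp φ ψ h2 h3 =>
      intro l
      have h4 : ev l (.imp φ ψ) = if ev l φ ≤ ev l ψ then 1 else ev l ψ := rfl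
      simp only [geval, h2, h3, h4]
      split_ifs with h5 h6 h6
      · exact h1.symm
      · rcases hstr _ (hDmem l ψ) _ (hDmem l φ) (not_le.1 h6) with h7 | h7
        · exact absurd h5 (not_le.2 h7)
        · exact h7.symm
      · exact absurd (hmon (hDmem _ _) (hDmem _ _) h6) h5
      · rfl
    | all ψ h2 =>
      intro l
      obtain ⟨f, hf, hfe, hinf, -⟩ := hquant l ψ
      have h3 : (fun m : w.M => geval w (consEnv m (envOf (⟨m₀, hm₀⟩ : S) l)) ψ) = h ∘ f := by
        funext m
        rw [consEnv_envOf, h2, Function.comp_apply, hfe]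
      simp only [geval, h3, ← hinf, range_comp]
      have : Nonempty S := ⟨⟨m₀, hm₀⟩⟩
      refine (MonotoneOn.map_csInf_of_continuousWithinAt ?_ (hmon.mono hf) (range_nonempty _)
        (hbd.1.mono hf)).symm
      exact (hcont _ (hinf ▸ hDmem _ _)).mono hf
    | ex ψ h2 =>
      intro l
      obtain ⟨f, hf, hfe, -, hsup⟩ := hquant l ψ
      have h3 : (fun m : w.M => geval w (consEnv m (envOf (⟨m₀, hm₀⟩ : S) l)) ψ) = h ∘ f := by
        funext m
        rw [consEnv_envOf, h2, Function.comp_apply, hfe]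
      simp only [geval, h3, ← hsup, range_comp]
      have : Nonempty S := ⟨⟨m₀, hm₀⟩⟩
      refine (MonotoneOn.map_csSup_of_continuousWithinAt ?_ (hmon.mono hf) (range_nonempty _)
        (hbd.2.mono hf)).symm
      exact (hcont _ (hsup ▸ hDmem _ _)).mono hf
  have h2 : w.val φ = h (v.val φ) := by
    rw [hval, ← key]
    exact geval_congr w hφ fun i hi => absurd hi (Nat.not_lt_zero i)
  exact hx₀.ne (h2 ▸ hφW w)

/-! ### Well-quasi-orders of codes -/

instance : IsPreorder Tm Tm.le where
  refl := Tm.le.refl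
  trans _ _ _ := Tm.le.trans

theorem wqo_tm : WellQuasiOrdered Tm.le := Tm.exists_lt_le

theorem wqo_list : WellQuasiOrdered (List.SublistForall₂ Tm.le) := by
  have h := ((partiallyWellOrderedOn_univ_iff.2 wqo_tm).partiallyWellOrderedOn_sublistForall₂
    Tm.le)
  simpa only [mem_univ, implies_true, ofPred_true, partiallyWellOrderedOn_univ_iff] using h

/-- The term describes a point that is a limit at most on side `d`. -/
def OneSided (d : Bool) (t : Tm) : Prop :=
  t = Tm.pt ∨ ∃ lab s, t = Tm.node lab s ∧ lab d = true ∧ lab (!d) = false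

theorem gle_of_le {d : Bool} {t t' : Tm} (ht : OneSided d t) (ht' : OneSided d t')
    (h : t.le t') : t.gle t' := by
  cases h with
  | pt => exact Tm.gle.pt _
  | node lab s s' g hg => exact Tm.gle.node lab s s' g hg
  | child _ lab s d' j hd h =>
    rcases ht with rfl | ⟨lab', s', rfl, h1, h2⟩
    · exact Tm.gle.pt _
    · rcases ht' with h3 | ⟨lab'', s'', h3, h4, h5⟩
      · cases h3
      · cases h3
        have hdd : d' = d := by
          cases d <;> cases d' <;> simp_all
        subst hdd
        have hlab : lab' = lab := by
          funext e
          cases e <;> cases d' <;> simp_all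
        subst hlab
        refine Tm.gle.node lab' s' s (fun _ _ => j) fun e i he => ?_
        have hed : e = d' := by
          cases e <;> cases d' <;> simp_all
        subst hed
        exact (Tm.le.child _ lab' s' e i he (Tm.le.refl _)).trans h

theorem countable_of_bad {C : Type} [Countable C] (F : Set (Set C))
    (hF : ∀ G : ℕ → Set C, (∀ n, G n ∈ F) → ∃ i j, i < j ∧ G j ⊆ G i) : F.Countable := by
  by_contra hunc
  have hI : ∃ I ⊆ F, ¬ I.Countable ∧ ∀ x ∈ I, {y ∈ I | ¬ y ⊆ x}.Countable := by
    by_contra! hcon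
    choose! x hx hbad using hcon
    let I : ℕ → Set (Set C) := fun n => Nat.rec F (fun _ I => {y ∈ I | ¬ y ⊆ x I}) n
    have hI : ∀ n, I n ⊆ F ∧ ¬ (I n).Countable := by
      intro n
      induction n with
      | zero => exact ⟨subset_rfl, hunc⟩
      | succ n ih => exact ⟨(sep_subset _ _).trans ih.1, hbad _ ih.1 ih.2⟩
    have hanti : Antitone I := antitone_nat_of_succ_le fun n => sep_subset _ _
    obtain ⟨i, j, hij, hsub⟩ := hF (fun n => x (I n)) fun n =>
      (hI n).1 (hx _ (hI n).1 (hI n).2)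
    exact (hanti (Nat.succ_le_of_lt hij) (hx _ (hI j).1 (hI j).2)).2 hsub
  obtain ⟨I, -, hIc, hI⟩ := hI
  have hJ : ∀ c : {c // c ∉ ⋂₀ I}, ∃ x ∈ I, c.1 ∉ x := fun c => by
    have := c.2
    simp only [mem_sInter, not_forall] at this
    obtain ⟨x, hx, hc⟩ := this
    exact ⟨x, hx, hc⟩
  choose x hxI hcx using hJ
  refine hIc (((countable_iUnion fun c => hI (x c) (hxI c)).union
    (countable_singleton (⋂₀ I))).mono fun y hy => ?_)
  by_cases hyJ : y ⊆ ⋂₀ I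
  · exact Or.inr (hyJ.antisymm (sInter_subset_of_mem hy))
  · obtain ⟨c, hc, hcJ⟩ := not_subset.1 hyJ
    exact Or.inl (mem_iUnion.2 ⟨⟨c, hcJ⟩, hy, fun h => hcx ⟨c, hcJ⟩ (h hc)⟩)

/-! ### Comparing Gödel sets -/

theorem leG_of_isEmb {V W : Set ℝ} {h : ℝ → ℝ} (hh : IsEmb h V W)
    (h0 : h 0 = 0) (h1 : h 1 = 1) : LeG V W := by
  intro D hDV _ _ h1D x hx hx1
  have hD := hh.mono hDV subset_rfl
  refine ⟨h, hD.2.2, hD.1, h0, h1, hD.2.1.monotoneOn, fun y hy z hz hyz =>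
    Or.inl (hD.2.1 hy hz hyz), h1 ▸ hD.2.1 hx h1D hx1⟩

theorem leG_of_trunc {V W : Set ℝ} (hV : GodelSet V) (hW : GodelSet W)
    (H : ∀ D ⊆ V, D.Countable → (0 : ℝ) ∈ D → ∀ w, 0 < w → w < 1 → w ∉ D →
      EmbPt (D ∩ Iio w) 0 (W ∩ Iio 1) 0) : LeG V W := by
  intro D hDV hD h0D h1D x hx hx1
  have hx0 := (hV.2.1 (hDV hx)).1
  obtain ⟨w, hwD, hxw, hw1⟩ := (hD.dense_compl ℝ).exists_between hx1
  obtain ⟨h, hh, h0⟩ := H D hDV hD h0D w (by linarith) hw1 hwD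
  have hlt : ∀ z ∈ D, z < w → h z < 1 := fun z hz hzw => (hh.1 ⟨hz, hzw⟩).2
  refine ⟨fun z => if z < w then h z else 1,
    continuousOn_cut hwD hh.2.2 continuousOn_const, fun z hz => ?_, ?_, ?_, ?_, ?_, ?_⟩
  · by_cases hzw : z < w
    · simp only [if_pos hzw]; exact (hh.1 ⟨hz, hzw⟩).1
    · simp only [if_neg hzw]; exact hW.2.2.2
  · simp only [if_pos (hx0.trans_lt hxw), h0]
  · simp only [if_neg (not_lt.2 hw1.le)]
  · intro y hy z hz hyz
    by_cases hzw : z < w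
    · simp only [if_pos hzw, if_pos (hyz.trans_lt hzw)]
      exact hh.2.1.monotoneOn ⟨hy, hyz.trans_lt hzw⟩ ⟨hz, hzw⟩ hyz
    · by_cases hyw : y < w
      · simp only [if_neg hzw, if_pos hyw]
        exact (hlt y hy hyw).le
      · simp only [if_neg hzw, if_neg hyw]
        exact le_rfl
  · intro y hy z hz hyz
    by_cases hyw : y < w
    · left
      by_cases hzw : z < w
      · simp only [if_pos hzw, if_pos hyw]
        exact hh.2.1 ⟨hy, hyw⟩ ⟨hz, hzw⟩ hyz
      · simp only [if_neg hzw, if_pos hyw]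
        exact hlt y hy hyw
    · right
      simp only [if_neg hyw]
  · simp only [if_pos hxw]
    exact hlt x hx hxw

theorem exists_uncountable_Icc {L : Set ℝ} {a b : ℝ} (h : ¬ (L ∩ Ioo a b).Countable) :
    ∃ p q, a < p ∧ q < b ∧ p ≤ q ∧ ¬ (L ∩ Icc p q).Countable := by
  by_contra! hcon
  refine h ((countable_iUnion fun p : {p : ℚ // a < p} => countable_iUnion
    fun q : {q : ℚ // (q : ℝ) < b} => ?_).mono
    (s₁ := L ∩ Ioo a b) (s₂ := ⋃ p : {p : ℚ // a < p}, ⋃ q : {q : ℚ // (q : ℝ) < b},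
      L ∩ Icc (p : ℝ) q) fun x hx => ?_)
  · rcases le_or_gt (p : ℝ) q with hpq | hpq
    · exact hcon _ _ p.2 q.2 hpq
    · rw [Icc_eq_empty hpq.not_ge, inter_empty]
      exact countable_empty
  · obtain ⟨p, h1, h2⟩ := exists_rat_btwn hx.2.1
    obtain ⟨q, h3, h4⟩ := exists_rat_btwn hx.2.2
    exact mem_iUnion.2 ⟨⟨p, h1⟩, mem_iUnion.2 ⟨⟨q, h4⟩, hx.1, h2.le, h3.le⟩⟩

/-! ### Codes of Gödel sets -/

theorem exists_germ_zero {K : Set ℝ} (hK : IsClosed K) (hc : K.Countable) (h0 : (0 : ℝ) ∈ K)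
    (hK0 : ∀ x ∈ K, 0 ≤ x) {δ : ℝ} (hδ : 0 < δ) :
    ∃ b t, 0 < b ∧ b < δ ∧ b ∉ K ∧ RealAt t (K ∩ Iio b) 0 ∧ OneSided false t := by
  obtain ⟨a, b, t, -, ha, hb, hbδ, -, hbK, ht, hform, hlab⟩ := exists_germ hK hc h0 hδ
  have hab : K ∩ Ioo a b = K ∩ Iio b := by
    ext z
    exact ⟨fun h => ⟨h.1, h.2.2⟩, fun h => ⟨h.1, ha.trans_le (hK0 z h.1), h.2⟩⟩
  rw [hab] at ht
  refine ⟨b, t, hb, by linarith, hbK, ht, ?_⟩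
  rcases hform with rfl | ⟨lab, s, rfl, d, hd⟩
  · exact Or.inl rfl
  · have htrue : lab true = false := by
      by_contra h
      obtain ⟨z, hz, -, hz0⟩ := hlab true (by simpa [Tm.lab] using h) (-1) (by simp [sg])
      rw [rfx_true] at hz
      simp only [sg, if_true] at hz0
      exact absurd hz0 (hK0 z hz).not_gt
    refine Or.inr ⟨lab, s, rfl, ?_, htrue⟩
    cases d
    · exact hd
    · exact absurd hd (by simp [htrue])

theorem exists_germ_one {K : Set ℝ} (hK : IsClosed K) (hc : K.Countable) (h1 : (1 : ℝ) ∈ K)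
    (hK1 : ∀ x ∈ K, x ≤ 1) {δ : ℝ} (hδ : 0 < δ) :
    ∃ a t, a < 1 ∧ 1 - δ < a ∧ a ∉ K ∧ RealAt t (K ∩ Ioi a) 1 ∧ OneSided true t := by
  obtain ⟨a, b, t, haδ, ha, hb, -, haK, -, ht, hform, hlab⟩ := exists_germ hK hc h1 hδ
  have hab : K ∩ Ioo a b = K ∩ Ioi a := by
    ext z
    exact ⟨fun h => ⟨h.1, h.2.1⟩, fun h => ⟨h.1, h.2, (hK1 z h.1).trans_lt hb⟩⟩
  rw [hab] at ht
  refine ⟨a, t, ha, haδ, haK, ht, ?_⟩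
  rcases hform with rfl | ⟨lab, s, rfl, d, hd⟩
  · exact Or.inl rfl
  · have hfalse : lab false = false := by
      by_contra h
      obtain ⟨z, hz, -, hz0⟩ := hlab false (by simpa [Tm.lab] using h) (-2)
        (by norm_num [sg])
      have hz' : -z ∈ K := by simpa [mem_rfx, sg] using hz
      simp only [sg, Bool.false_eq_true, if_false] at hz0
      linarith [hK1 _ hz']
    refine Or.inr ⟨lab, s, rfl, ?_, hfalse⟩
    cases d
    · exact absurd hd (by simp [hfalse])
    · exact hd

/-- A code of a countable Gödel set: its germs at `0` and `1` and the rest. -/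
def CodeCountable (V : Set ℝ) (c : Tm × Tm × List Tm) : Prop :=
  ∃ b a, 0 < b ∧ b < a ∧ a < 1 ∧ b ∉ V ∧ a ∉ V ∧ RealAt c.1 (V ∩ Iio b) 0 ∧
    OneSided false c.1 ∧ RealAt c.2.1 (V ∩ Ioi a) 1 ∧ OneSided true c.2.1 ∧
    SumOf Realizes c.2.2 (V ∩ Ioo b a)

theorem exists_codeCountable {V : Set ℝ} (hV : GodelSet V) (hc : V.Countable) :
    ∃ c, CodeCountable V c := by
  obtain ⟨hcl, hsub, h0, h1⟩ := hV
  obtain ⟨b, t, hb0, hb, hbV, ht, hto⟩ := exists_germ_zero hcl hc h0 (fun x hx => (hsub hx).1)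
    (δ := 1 / 2) (by norm_num)
  obtain ⟨a, u, ha1, ha, haV, hu, huo⟩ := exists_germ_one hcl hc h1 (fun x hx => (hsub hx).2)
    (δ := 1 / 2) (by norm_num)
  have hba : b < a := by linarith
  obtain ⟨l, hl⟩ := dec_Ioo hcl hc hba hbV haV
  exact ⟨(t, u, l), b, a, hb0, hba, ha1, hbV, haV, ht, hto, hu, huo, hl⟩

theorem leG_of_codeCountable {V W : Set ℝ} {c c' : Tm × Tm × List Tm}
    (hV : CodeCountable V c) (hW : CodeCountable W c')
    (h : c.1.le c'.1 ∧ c.2.1.le c'.2.1 ∧ List.SublistForall₂ Tm.le c.2.2 c'.2.2) :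
    LeG V W := by
  obtain ⟨b, a, hb, hba, ha, hbV, haV, ht, hto, hu, huo, hl⟩ := hV
  obtain ⟨b', a', hb', hba', ha', hbW, haW, ht', hto', hu', huo', hl'⟩ := hW
  obtain ⟨f, hf, hf0⟩ := embPt_of_gle (gle_of_le hto hto' h.1) ht.1 ht'.2
  obtain ⟨g, hg⟩ := SumOf.emb_of_sublistForall₂ (P := Realizes) (Q := Realizes)
    (fun _ _ _ _ hR hP hQ => emb_of_real hR hP hQ) h.2.2 hl hl'
  obtain ⟨k, hk, hk1⟩ := embPt_of_gle (gle_of_le huo huo' h.2.1) hu.1 hu'.2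
  have hgk := IsEmb.glue_cut (K := V ∩ Ioi b) (fun h => haV h.1)
    (hg.mono (K' := V ∩ Ioi b ∩ Iio a) (fun z hz => ⟨hz.1.1, hz.1.2, hz.2⟩) subset_rfl)
    (hk.mono (K' := V ∩ Ioi b ∩ Ioi a) (fun z hz => ⟨hz.1.1, hz.2⟩) subset_rfl)
    (fun x hx y hy => hx.2.2.trans hy.2)
  have hfgk := hf.glue_cut hbV hgk (by
    rintro x hx y (hy | hy)
    · exact lt_trans hx.2 hy.2.1
    · exact lt_trans hx.2 (hba'.trans hy.2))
  refine leG_of_isEmb (hfgk.mono subset_rfl (union_subset inter_subset_left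
    (union_subset inter_subset_left inter_subset_left))) ?_ ?_
  · simp only [if_pos hb, hf0]
  · simp only [if_neg (hba.trans ha).not_gt, if_neg ha.not_gt, hk1]

/-- A code of an uncountable Gödel set that is countable near `0`. -/
def CodeGerm (V : Set ℝ) (t : Tm) : Prop :=
  ∃ a, 0 < a ∧ a < 1 ∧ a ∉ V ∧ (V ∩ Iio a).Countable ∧ RealAt t (V ∩ Iio a) 0 ∧
    OneSided false t

theorem exists_codeGerm {V : Set ℝ} (hV : GodelSet V) {ε : ℝ} (hε : 0 < ε)
    (hc : (V ∩ Iic ε).Countable) : ∃ t, CodeGerm V t := by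
  obtain ⟨hcl, hsub, h0, -⟩ := hV
  obtain ⟨a, t, ha0, ha, haK, ht, hto⟩ := exists_germ_zero (hcl.inter isClosed_Iic) hc
    ⟨h0, hε.le⟩ (fun x hx => (hsub hx.1).1) (lt_min hε one_pos)
  have haε : a < ε := ha.trans_le (min_le_left _ _)
  have he : V ∩ Iic ε ∩ Iio a = V ∩ Iio a := by
    ext z
    exact ⟨fun h => ⟨h.1.1, h.2⟩, fun h => ⟨⟨h.1, (lt_trans h.2 haε).le⟩, h.2⟩⟩
  rw [he] at ht
  exact ⟨t, a, ha0, ha.trans_le (min_le_right _ _), fun h => haK ⟨h, haε.le⟩,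
    hc.mono (inter_subset_inter_right _ fun z hz => (lt_trans hz haε).le), ht, hto⟩

theorem leG_of_codeGerm {V W : Set ℝ} {t t' : Tm} (hV : GodelSet V) (hW : GodelSet W)
    (hWc : ¬ W.Countable) (ht : CodeGerm V t) (ht' : CodeGerm W t') (h : t.le t') :
    LeG V W := by
  obtain ⟨a, ha, ha1, haV, -, hr, ho⟩ := ht
  obtain ⟨a', ha', ha1', haW, hWc', hr', ho'⟩ := ht'
  refine leG_of_trunc hV hW fun D hDV hD h0D w hw hw1 hwD => ?_
  obtain ⟨f, hf, hf0⟩ := embPt_of_gle (gle_of_le ho ho' h) hr.1 hr'.2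
  have hunc : ¬ (W ∩ Ioo a' 1).Countable := fun hcon => hWc <|
    ((hWc'.union hcon).union (countable_singleton 1)).mono fun z hz => by
      rcases (hW.2.1 hz).2.eq_or_lt with rfl | hz1
      · exact Or.inr rfl
      · refine Or.inl ?_
        rcases lt_trichotomy z a' with hza | rfl | hza
        · exact Or.inl ⟨hz, hza⟩
        · exact absurd hz haW
        · exact Or.inr ⟨hz, hza, hz1⟩
  obtain ⟨p, q, hp, hq, -, hpq⟩ := exists_uncountable_Icc hunc
  obtain ⟨g, hg⟩ := emb_of_uncountable (hD.mono (s₁ := D ∩ Iio w ∩ Ioi a) fun z hz => hz.1.1)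
    (hW.1.inter isClosed_Icc) hpq
  refine ⟨_, (IsEmb.glue_cut (K := D ∩ Iio w) (fun h => haV (hDV h.1))
    (hf.mono (fun z hz => ⟨hDV hz.1.1, hz.2⟩) subset_rfl) hg
    fun x hx y hy => lt_trans hx.2 (hp.trans_le hy.2.1)).mono subset_rfl ?_, ?_⟩
  · exact union_subset (inter_subset_inter_right _ fun z hz => lt_trans hz ha1')
      (inter_subset_inter_right _ fun z hz => hz.2.trans_lt hq)
  · simp only [if_pos ha, hf0]

theorem leG_of_uncountable_near_zero {V W : Set ℝ} (hV : GodelSet V) (hW : GodelSet W)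
    (hunc : ∀ ε > 0, ¬ (W ∩ Iic ε).Countable) : LeG V W := by
  refine leG_of_trunc hV hW fun D hDV hD h0D w hw hw1 hwD => EmbPt.of_rfx false ?_
  have h00 : sg false 0 = 0 := by simp [sg]
  rw [h00]
  have hK : ∀ z ∈ rfx false (D ∩ Iio w), -1 < z ∧ z ≤ 0 := by
    rintro z ⟨hz, hzw⟩
    have h1 : (0 : ℝ) ≤ sg false z := (hV.2.1 (hDV hz)).1
    have h2 : sg false z < w := hzw
    simp only [sg, Bool.false_eq_true, if_false] at h1 h2
    constructor <;> linarith
  have hKc : (rfx false (D ∩ Iio w)).Countable :=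
    Countable.rfx (hD.mono inter_subset_left) false
  obtain ⟨u, hu, huI, hu0⟩ := (hKc.dense_compl ℝ).exists_seq_strictMono_tendsto_of_lt
    (show (-1 : ℝ) < 0 by norm_num)
  let c : ℕ → ℝ := fun n => Nat.casesOn n (-2) u
  have hcm : StrictMono c := strictMono_nat_of_lt_succ fun n => by
    cases n with
    | zero => exact (show (-2 : ℝ) < -1 by norm_num).trans (huI 0).1.1
    | succ n => exact hu n.lt_succ_self
  have hc0 : Filter.Tendsto c Filter.atTop (nhds 0) :=
    (Filter.tendsto_add_atTop_iff_nat 1).1 hu0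
  have hcK : ∀ i, c i ∉ rfx false (D ∩ Iio w) := fun i => by
    cases i with
    | zero => exact fun h => absurd (hK _ h).1 (by norm_num [c])
    | succ n => exact (huI n).2
  have key := embPt_of_tendsto (x := 0) (K' := rfx false (W ∩ Iio 1)) (x' := 0) c hcm hc0 hcK
    (fun z hz => (show (-2 : ℝ) < -1 by norm_num).trans (hK z hz.1).1)
    (by rw [mem_rfx, h00]; exact ⟨hW.2.2.1, mem_Iio.2 one_pos⟩) fun i y hy => ?_
  · rw [inter_eq_left.2 (show _ ⊆ Iic (0 : ℝ) from fun z hz => (hK z hz).2)] at key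
    obtain ⟨h, hh, hh0⟩ := key
    exact ⟨h, hh.mono subset_rfl inter_subset_left, hh0⟩
  · have hm : max y (-1) < 0 := max_lt hy (by norm_num)
    have hunc' : ¬ (rfx false W ∩ Ioo (max y (-1)) 0).Countable := fun hcon => by
      have h1 := Countable.rfx hcon false
      rw [rfx_inter, rfx_rfx, rfx_false_Ioo, neg_zero] at h1
      refine hunc (-max y (-1) / 2) (by linarith) ((h1.union (countable_singleton 0)).mono ?_)
      rintro z ⟨hz, hz' : z ≤ _⟩
      rcases (hW.2.1 hz).1.eq_or_lt with rfl | hz0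
      · exact Or.inr rfl
      · exact Or.inl ⟨hz, hz0, by linarith⟩
    obtain ⟨p, q, hp, hq, hpq, hpqc⟩ := exists_uncountable_Icc hunc'
    have hE := emb_of_uncountable (hKc.mono (s₁ := _ ∩ Ioo (c i) (c (i + 1))) inter_subset_left)
      ((hW.1.preimage (continuous_sg false)).inter isClosed_Icc) hpqc
    have hyp := (le_max_left y (-1)).trans_lt hp
    have hp1 := (le_max_right y (-1)).trans_lt hp
    refine ⟨q / 2, by linarith, by linarith, hE.mono subset_rfl ?_⟩
    rintro z ⟨hz, hz1, hz2⟩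
    refine ⟨⟨hz, ?_⟩, by linarith, by linarith⟩
    show sg false z < 1
    simp only [sg, Bool.false_eq_true, if_false]
    linarith

/-! ### Countability -/

theorem countable_logics {ar : ℕ → ℕ} (P : Set ℝ → Prop)
    (H : ∀ V : ℕ → Set ℝ, (∀ n, GodelSet (V n) ∧ P (V n)) → ∃ i j, i < j ∧ LeG (V i) (V j)) :
    {G : Set (GFormula ar) | ∃ V, (GodelSet V ∧ P V) ∧ G = GLogic ar V}.Countable := by
  have := countable_formula ar
  refine countable_of_bad _ fun G hG => ?_
  choose V hV hGV using hG
  obtain ⟨i, j, hij, h⟩ := H V hV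
  exact ⟨i, j, hij, by rw [hGV i, hGV j]; exact gLogic_subset_of_leG (hV i).1 (hV j).1 h⟩

theorem countable_logics_countable (ar : ℕ → ℕ) :
    {G : Set (GFormula ar) | ∃ V, (GodelSet V ∧ V.Countable) ∧ G = GLogic ar V}.Countable := by
  refine countable_logics _ fun V hV => ?_
  choose c hc using fun n => exists_codeCountable (hV n).1 (hV n).2
  obtain ⟨i, j, hij, h⟩ := (wqo_tm.prod (wqo_tm.prod wqo_list)) c
  exact ⟨i, j, hij, leG_of_codeCountable (hc i) (hc j) h⟩

theorem countable_logics_germ (ar : ℕ → ℕ) :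
    {G : Set (GFormula ar) | ∃ V, (GodelSet V ∧ ¬ V.Countable ∧ ∃ ε > 0, (V ∩ Iic ε).Countable) ∧
      G = GLogic ar V}.Countable := by
  refine countable_logics _ fun V hV => ?_
  have hcode : ∀ n, ∃ t, CodeGerm (V n) t := fun n => by
    obtain ⟨h1, -, ε, hε, h2⟩ := hV n
    exact exists_codeGerm h1 hε h2
  choose c hc using hcode
  obtain ⟨i, j, hij, h⟩ := wqo_tm c
  exact ⟨i, j, hij, leG_of_codeGerm (hV i).1 (hV j).1 (hV j).2.1 (hc i) (hc j) h⟩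

theorem countable_logics_uncountable_near_zero (ar : ℕ → ℕ) :
    {G : Set (GFormula ar) | ∃ V, (GodelSet V ∧ ∀ ε > 0, ¬ (V ∩ Iic ε).Countable) ∧
      G = GLogic ar V}.Countable :=
  countable_logics _ fun _ hV =>
    ⟨0, 1, one_pos, leG_of_uncountable_near_zero (hV 0).1 (hV 1).1 (hV 1).2⟩

end GodelCount

/-- The set of all Gödel logics is countable. -/
theorem stmt17 (ar : ℕ → ℕ) :
    Set.Countable {G : Set (GFormula ar) | ∃ V : Set ℝ, GodelSet V ∧ G = GLogic ar V} := by
  refine (((GodelCount.countable_logics_countable ar).union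
    (GodelCount.countable_logics_germ ar)).union
    (GodelCount.countable_logics_uncountable_near_zero ar)).mono ?_
  rintro G ⟨V, hV, hG⟩
  by_cases h0 : ∃ ε > 0, (V ∩ Iic ε).Countable
  · by_cases h1 : V.Countable
    · exact Or.inl (Or.inl ⟨V, ⟨hV, h1⟩, hG⟩)
    · exact Or.inl (Or.inr ⟨V, ⟨hV, h1, h0⟩, hG⟩)
  · push Not at h0
    exact Or.inr ⟨V, ⟨hV, h0⟩, hG⟩
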